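/- arXiv:1204.0741 — 3 statements merged into one kernel-verified Lean document; each statement's English description precedes it below -/
import Mathlib

section
/- The push-forward of the Fubini–Study (Liouville) probability measure on ℙ(ℂ^{n+1}) along the map [z₀:…:z_n] ↦ (|z₀|²,…,|z_n|²)/(Σ|z_k|²) is the uniform (Lebesgue) probability measure on the standard n-simplex Δ_n = { p ∈ ℝ^{n+1} : p_k ≥ 0, Σ p_k = 1 }. -/
open scoped BigOperators ENNReal
open MeasureTheory

lemma aux_map_norm_sq :
    Measure.map (fun z : ℂ => Real.pi * ‖z‖ ^ 2) volume
      = (volume : Measure ℝ).restrict (Set.Ioi 0) := by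
  refine Measure.ext_of_lintegral _ fun f hf => ?_
  rw [lintegral_map hf (by fun_prop), ← Complex.lintegral_comp_polarCoord_symm]
  have h1 : ∀ p ∈ polarCoord.target,
      ENNReal.ofReal p.1 • f (Real.pi * ‖Complex.polarCoord.symm p‖ ^ 2)
        = ENNReal.ofReal p.1 * f (Real.pi * p.1 ^ 2) := by
    intro p hp
    simp
  have hm : MeasurableSet polarCoord.target := polarCoord.open_target.measurableSet
  rw [setLIntegral_congr_fun hm h1, polarCoord_target, Measure.volume_eq_prod,
    ← Measure.prod_restrict, lintegral_prod _ (by fun_prop)]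
  simp only [lintegral_const, Measure.restrict_apply_univ, Real.volume_Ioo]
  have h2 := lintegral_image_eq_lintegral_abs_deriv_mul (s := Set.Ioi (0 : ℝ))
    (f := fun r => Real.pi * r ^ 2) (f' := fun r => Real.pi * (2 * r)) measurableSet_Ioi
    (fun x _ => by
      have := ((hasDerivAt_pow 2 x).const_mul Real.pi).hasDerivWithinAt (s := Set.Ioi 0)
      simpa using this)
    (fun x hx y hy h => by
      have : x ^ 2 = y ^ 2 := mul_left_cancel₀ Real.pi_ne_zero h
      exact (pow_left_inj₀ (le_of_lt hx) (le_of_lt hy) two_ne_zero).1 this) f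
  have h3 : (fun r : ℝ => Real.pi * r ^ 2) '' Set.Ioi 0 = Set.Ioi 0 := by
    ext t
    constructor
    · rintro ⟨r, hr, rfl⟩
      have : (0:ℝ) < r := hr
      exact Set.mem_Ioi.2 (by positivity)
    · intro ht
      have ht' : 0 < t := ht
      refine ⟨Real.sqrt (t / Real.pi), Real.sqrt_pos.2 (by positivity), ?_⟩
      simp only
      rw [Real.sq_sqrt (by positivity)]
      field_simp
  rw [h3] at h2
  rw [h2]
  refine setLIntegral_congr_fun measurableSet_Ioi fun r hr => ?_
  have hr' : (0:ℝ) < r := hr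
  rw [abs_of_pos (by positivity), mul_right_comm, ← ENNReal.ofReal_mul hr'.le]
  congr 2
  ring

/-- Orthant measure -/
lemma aux_map_pi (m : ℕ) :
    Measure.map (fun (z : Fin m → ℂ) k => Real.pi * ‖z k‖ ^ 2) volume
      = (volume : Measure (Fin m → ℝ)).restrict (Set.univ.pi fun _ => Set.Ioi 0) := by
  have : ∀ i : Fin m, SigmaFinite
      (Measure.map (fun z : ℂ => Real.pi * ‖z‖ ^ 2) (volume : Measure ℂ)) := by
    intro i; rw [aux_map_norm_sq]; infer_instance
  have h := Measure.pi_map_pi (ι := Fin m) (hμ := this) (fun i => by fun_prop)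
  rw [volume_pi, volume_pi, Measure.restrict_pi_pi, h]
  simp_rw [aux_map_norm_sq]

lemma aux_mass (m : ℕ) :
    ∫⁻ x : Fin m → ℝ in Set.univ.pi fun _ => Set.Ioi 0, ENNReal.ofReal (Real.exp (-∑ i, x i)) = 1 := by
  rw [volume_pi, Measure.restrict_pi_pi]
  have h : ∀ x : Fin m → ℝ, Real.exp (-∑ i, x i) = ∏ i, Real.exp (-x i) := by
    intro x; rw [← Finset.sum_neg_distrib, Real.exp_sum]
  simp_rw [h]
  have hi : Integrable (fun t : ℝ => Real.exp (-t)) (volume.restrict (Set.Ioi 0)) := by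
    have := integrableOn_exp_neg_Ioi (0:ℝ)
    exact this
  rw [← ofReal_integral_eq_lintegral_ofReal]
  · rw [integral_fintype_prod_eq_prod (fun _ t => Real.exp (-t))]
    rw [integral_exp_neg_Ioi]
    simp
  · exact Integrable.fintype_prod (f := fun _ t => Real.exp (-t)) (fun _ => hi)
  · exact Filter.Eventually.of_forall fun x => Finset.prod_nonneg fun i _ => (Real.exp_pos _).le

lemma aux_gamma (n : ℕ) :
    ∫⁻ s : ℝ in Set.Ioi 0, ENNReal.ofReal (Real.exp (-s)) * ENNReal.ofReal (s ^ n)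
      = (n.factorial : ℝ≥0∞) := by
  have h0 : (0:ℝ) < (n:ℝ) + 1 := by positivity
  have hc : ∀ s ∈ Set.Ioi (0:ℝ), Real.exp (-s) * s ^ ((n:ℝ) + 1 - 1) = Real.exp (-s) * s ^ n := by
    intro s hs
    simp
  have h1 : ∫ s in Set.Ioi (0:ℝ), Real.exp (-s) * s ^ n = n.factorial := by
    rw [← Real.Gamma_nat_eq_factorial, Real.Gamma_eq_integral h0]
    exact (setIntegral_congr_fun measurableSet_Ioi hc).symm
  have h2 : IntegrableOn (fun s : ℝ => Real.exp (-s) * s ^ n) (Set.Ioi 0) :=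
    (integrableOn_congr_fun hc measurableSet_Ioi).1 (Real.GammaIntegral_convergent h0)
  simp_rw [← ENNReal.ofReal_mul (Real.exp_pos _).le]
  rw [← ofReal_integral_eq_lintegral_ofReal h2, h1, ENNReal.ofReal_natCast]
  filter_upwards [ae_restrict_mem measurableSet_Ioi] with s hs
  have : (0:ℝ) < s := hs
  positivity

lemma aux_scale (n : ℕ) (s : ℝ) (hs : 0 < s) (g : (Fin n → ℝ) → ℝ≥0∞) (hg : Measurable g) :
    ∫⁻ y, g y = ENNReal.ofReal (s ^ n) * ∫⁻ y, g (s • y) := by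
  have h := Measure.map_addHaar_smul (volume : Measure (Fin n → ℝ)) hs.ne'
  have h2 : ∫⁻ y, g (s • y) = ∫⁻ y, g y ∂(Measure.map (fun y => s • y) volume) := by
    rw [lintegral_map hg (by fun_prop)]
  rw [h2, h, lintegral_smul_measure, smul_eq_mul, ← mul_assoc, ← ENNReal.ofReal_mul (by positivity)]
  simp only [Module.finrank_fintype_fun_eq_card, Fintype.card_fin]
  rw [abs_of_pos (by positivity), mul_inv_cancel₀ (by positivity)]
  simp

lemma aux_simplex (n : ℕ) (f : (Fin (n + 1) → ℝ) → ℝ≥0∞) (hf : Measurable f) :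
    ∫⁻ x : Fin (n + 1) → ℝ in Set.univ.pi fun _ => Set.Ioi 0,
        ENNReal.ofReal (Real.exp (-∑ i, x i)) * f (fun k => x k / ∑ j, x j)
      = (n.factorial : ℝ≥0∞) * ∫⁻ y : Fin n → ℝ in {y | (∀ i, 0 ≤ y i) ∧ ∑ i, y i ≤ 1},
          f (Fin.cons (1 - ∑ i, y i) y) := by
  have hae : (Set.univ.pi fun _ : Fin (n + 1) => Set.Ioi (0:ℝ)) =ᵐ[volume] Set.Ici fun _ => 0 :=
    Measure.univ_pi_Ioi_ae_eq_Ici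
  rw [setLIntegral_congr hae]
  set A : Set (Fin (n + 1) → ℝ) := Set.Ici fun _ => 0 with hA
  have hAm : MeasurableSet A := measurableSet_Ici
  set F : (Fin (n + 1) → ℝ) → ℝ≥0∞ := A.indicator fun x =>
        ENNReal.ofReal (Real.exp (-∑ i, x i)) * f (fun k => x k / ∑ j, x j) with hF
  have hFm : Measurable F := by
    apply Measurable.indicator _ hAm
    fun_prop
  have hcons : Measurable (fun p : ℝ × (Fin n → ℝ) => (Fin.cons p.1 p.2 : Fin (n + 1) → ℝ)) := by
    refine measurable_pi_lambda _ fun i => ?_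
    refine Fin.cases ?_ (fun j => ?_) i
    · simpa using measurable_fst
    · simp only [Fin.cons_succ]; fun_prop
  set T : Set (Fin n → ℝ) := {y | (∀ i, 0 ≤ y i) ∧ ∑ i, y i ≤ 1} with hT
  have hTm : MeasurableSet T := by
    have : T = (⋂ i, {y | 0 ≤ y i}) ∩ {y | ∑ i, y i ≤ 1} := by ext; simp [hT]
    rw [this]
    exact (MeasurableSet.iInter fun i => measurableSet_le (by fun_prop) (by fun_prop)).inter
      (measurableSet_le (by fun_prop) (by fun_prop))
  set I : ℝ≥0∞ := ∫⁻ y in T, f (Fin.cons (1 - ∑ i, y i) y) with hI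
  have step1 : ∫⁻ x in A, ENNReal.ofReal (Real.exp (-∑ i, x i)) * f (fun k => x k / ∑ j, x j)
      = ∫⁻ y : Fin n → ℝ, ∫⁻ t : ℝ, F (Fin.cons t y) := by
    rw [← lintegral_indicator hAm]
    have := (volume_preserving_piFinSuccAbove (fun _ : Fin (n + 1) => ℝ) 0).symm.lintegral_comp hFm
    rw [← this, Measure.volume_eq_prod, lintegral_prod_symm']
    · simp [MeasurableEquiv.piFinSuccAbove, Fin.insertNthEquiv]
    · exact hFm.comp (MeasurableEquiv.measurable _)
  have step2 : ∀ y : Fin n → ℝ, ∫⁻ t : ℝ, F (Fin.cons t y)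
      = ∫⁻ s : ℝ, F (Fin.cons (s - ∑ i, y i) y) := by
    intro y
    exact (lintegral_sub_right_eq_self (fun t => F (Fin.cons t y)) (∑ i, y i)).symm
  have hGm : Measurable (fun p : (Fin n → ℝ) × ℝ => F (Fin.cons (p.2 - ∑ i, p.1 i) p.1)) := by
    have : Measurable (fun p : (Fin n → ℝ) × ℝ => (p.2 - ∑ i, p.1 i, p.1)) := by fun_prop
    exact hFm.comp (hcons.comp this)
  have step3 : ∀ᵐ s : ℝ, ∫⁻ y, F (Fin.cons (s - ∑ i, y i) y)
      = (Set.Ioi (0:ℝ)).indicator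
          (fun s => ENNReal.ofReal (Real.exp (-s)) * ENNReal.ofReal (s ^ n) * I) s := by
    filter_upwards [Measure.ae_ne volume (0:ℝ)] with s hs0
    by_cases hs : 0 < s
    · rw [Set.indicator_of_mem (Set.mem_Ioi.2 hs),
        aux_scale n s hs (fun y => F (Fin.cons (s - ∑ i, y i) y))
          (hGm.comp (measurable_id.prodMk measurable_const))]
      have : ∀ y : Fin n → ℝ, F (Fin.cons (s - ∑ i, (s • y) i) (s • y))
          = ENNReal.ofReal (Real.exp (-s)) *
            T.indicator (fun y => f (Fin.cons (1 - ∑ i, y i) y)) y := by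
        intro y
        have hsum : s - ∑ i, (s • y) i = s * (1 - ∑ i, y i) := by
          simp [← Finset.mul_sum, mul_sub]
        have hmem : (Fin.cons (s - ∑ i, (s • y) i) (s • y) : Fin (n + 1) → ℝ) ∈ A ↔ y ∈ T := by
          rw [hsum]
          simp [hA, hT, Pi.le_def, Fin.forall_fin_succ, hs, and_comm]
        by_cases hy : y ∈ T
        · rw [Set.indicator_of_mem hy, hF, Set.indicator_of_mem (hmem.2 hy)]
          have htot : ∑ i, (Fin.cons (s - ∑ i, (s • y) i) (s • y) : Fin (n + 1) → ℝ) i = s := by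
            simp [Fin.sum_univ_succ]
          rw [htot]
          congr 2
          ext k
          refine Fin.cases ?_ (fun j => ?_) k
          · rw [Fin.cons_zero, Fin.cons_zero, hsum]; field_simp
          · simp only [Fin.cons_succ, Pi.smul_apply, smul_eq_mul]; field_simp
        · rw [Set.indicator_of_notMem hy, hF, Set.indicator_of_notMem (fun h => hy (hmem.1 h)),
            mul_zero]
      simp_rw [this]
      rw [lintegral_const_mul' _ _ ENNReal.ofReal_ne_top, lintegral_indicator hTm, ← hI]
      ring
    · rw [Set.indicator_of_notMem (by simpa using hs)]
      have : ∀ y : Fin n → ℝ, F (Fin.cons (s - ∑ i, y i) y) = 0 := by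
        intro y
        rw [hF]
        refine Set.indicator_of_notMem (fun h => hs ?_) _
        have h' : ∀ i, 0 ≤ (Fin.cons (s - ∑ i, y i) y : Fin (n + 1) → ℝ) i := by
          simpa [hA, Pi.le_def] using h
        have h0 := h' 0
        have h1 : 0 ≤ ∑ i, y i := Finset.sum_nonneg fun i _ => by
          have := h' i.succ
          simp only [Fin.cons_succ] at this
          exact this
        simp only [Fin.cons_zero] at h0
        exact lt_of_le_of_ne (by linarith) (Ne.symm hs0)
      simp [this]
  rw [step1]
  simp_rw [step2]
  rw [lintegral_lintegral_swap hGm.aemeasurable]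
  rw [lintegral_congr_ae step3, lintegral_indicator measurableSet_Ioi, lintegral_mul_const _ (by fun_prop), aux_gamma, hI]


/-- real inner product on `ℂ^m` -/
noncomputable def auxB {m : ℕ} (w z : Fin m → ℂ) : ℝ := ∑ k, (star (w k) * z k).re

lemma auxB_comm {m : ℕ} (w z : Fin m → ℂ) : auxB w z = auxB z w := by
  unfold auxB
  refine Finset.sum_congr rfl fun k _ => ?_
  simp; ring

lemma auxB_smul {m : ℕ} (t : ℝ) (w z : Fin m → ℂ) : auxB (t • w) z = t * auxB w z := by
  unfold auxB
  rw [Finset.mul_sum]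
  refine Finset.sum_congr rfl fun k _ => ?_
  simp; ring

lemma auxB_eq {m : ℕ} (w z : Fin m → ℂ) : auxB w z = (star w ⬝ᵥ z).re := by
  simp [auxB, dotProduct]

lemma auxB_mulVec {m : ℕ} (U : Matrix (Fin m) (Fin m) ℂ) (w z : Fin m → ℂ) :
    auxB (U.mulVec w) z = auxB w ((star U).mulVec z) := by
  rw [auxB_eq, auxB_eq, Matrix.star_mulVec, Matrix.dotProduct_mulVec]
  rfl

lemma auxB_self {m : ℕ} (z : Fin m → ℂ) : auxB z z = ∑ k, ‖z k‖ ^ 2 := by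
  unfold auxB
  refine Finset.sum_congr rfl fun k _ => ?_
  rw [Complex.sq_norm, Complex.normSq_apply]
  simp

lemma auxB_cont {m : ℕ} : Continuous fun p : (Fin m → ℂ) × (Fin m → ℂ) => auxB p.1 p.2 := by
  unfold auxB
  fun_prop

lemma auxB_dual {m : ℕ} (L : StrongDual ℝ (Fin m → ℂ)) : ∃ w, ∀ z, L z = auxB w z := by
  refine ⟨fun k => ⟨L (Pi.single k 1), L (Pi.single k Complex.I)⟩, fun z => ?_⟩
  have hz : z = ∑ k, ((z k).re • (Pi.single k 1 : Fin m → ℂ)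
      + (z k).im • (Pi.single k Complex.I : Fin m → ℂ)) := by
    ext j
    rw [Finset.sum_apply, Finset.sum_eq_single j]
    · simp
    · intro b _ hb
      simp [hb.symm]
    · simp
  conv_lhs => rw [hz]
  rw [map_sum]
  unfold auxB
  refine Finset.sum_congr rfl fun k _ => ?_
  simp; ring

lemma aux_unitary_sum {m : ℕ} (U : Matrix.unitaryGroup (Fin m) ℂ) (z : Fin m → ℂ) :
    ∑ k, ‖((U : Matrix (Fin m) (Fin m) ℂ).mulVec z) k‖ ^ 2 = ∑ k, ‖z k‖ ^ 2 := by
  rw [← auxB_self, ← auxB_self, auxB_mulVec, Matrix.mulVec_mulVec]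
  have : star (U : Matrix (Fin m) (Fin m) ℂ) * U = 1 := Matrix.UnitaryGroup.star_mul_self U
  rw [this, Matrix.one_mulVec]

lemma aux_trans {n : ℕ} (v : Fin (n + 1) → ℂ) (hv : ∑ k, ‖v k‖ ^ 2 = 1) :
    ∃ U : Matrix.unitaryGroup (Fin (n + 1)) ℂ,
      (U : Matrix (Fin (n + 1)) (Fin (n + 1)) ℂ).mulVec (Pi.single 0 1) = v := by
  have hn : ‖(WithLp.toLp 2 v : EuclideanSpace ℂ (Fin (n + 1)))‖ = 1 := by
    rw [EuclideanSpace.norm_eq]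
    simp [hv]
  have ho : Orthonormal ℂ (({0} : Set (Fin (n + 1))).domRestrict
      (fun _ => (WithLp.toLp 2 v : EuclideanSpace ℂ (Fin (n + 1))))) := by
    refine ⟨fun i => hn, fun i j hij => ?_⟩
    exact absurd (Subsingleton.elim i j) hij
  obtain ⟨b, hb⟩ := ho.exists_orthonormalBasis_extension_of_card_eq (by simp)
  have hU := (EuclideanSpace.basisFun (Fin (n + 1)) ℂ).toMatrix_orthonormalBasis_mem_unitary b
  refine ⟨⟨_, hU⟩, ?_⟩
  ext k
  simp [Module.Basis.toMatrix_apply, hb 0 rfl]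

lemma aux_char_const {n : ℕ} (μ : Measure (Fin (n + 1) → ℂ))
    (hinv : ∀ U : Matrix.unitaryGroup (Fin (n + 1)) ℂ,
      Measure.map (fun z => (U : Matrix (Fin (n + 1)) (Fin (n + 1)) ℂ).mulVec z) μ = μ)
    (t : ℝ) (v : Fin (n + 1) → ℂ) (hv : ∑ k, ‖v k‖ ^ 2 = 1) :
    ∫ z, Complex.exp ((t * auxB v z : ℝ) * Complex.I) ∂μ
      = ∫ z, Complex.exp ((t * auxB (Pi.single 0 1) z : ℝ) * Complex.I) ∂μ := by
  obtain ⟨U, rfl⟩ := aux_trans v hv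
  have hc : Continuous fun z : Fin (n + 1) → ℂ => auxB (Pi.single 0 1) z :=
    auxB_cont.comp (by fun_prop : Continuous fun z : Fin (n + 1) → ℂ =>
      ((Pi.single 0 1 : Fin (n + 1) → ℂ), z))
  conv_rhs => rw [← hinv (star U)]
  rw [integral_map]
  · simp_rw [auxB_mulVec]
    rfl
  · exact (Continuous.matrix_mulVec continuous_const continuous_id).aemeasurable
  · exact Continuous.aestronglyMeasurable (by fun_prop)

lemma aux_unique {n : ℕ} (μ ν : Measure (Fin (n + 1) → ℂ)) [IsProbabilityMeasure μ]
    [IsProbabilityMeasure ν]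
    (hμs : ∀ᵐ z ∂μ, ∑ k, ‖z k‖ ^ 2 = 1) (hνs : ∀ᵐ z ∂ν, ∑ k, ‖z k‖ ^ 2 = 1)
    (hμ : ∀ U : Matrix.unitaryGroup (Fin (n + 1)) ℂ,
      Measure.map (fun z => (U : Matrix (Fin (n + 1)) (Fin (n + 1)) ℂ).mulVec z) μ = μ)
    (hν : ∀ U : Matrix.unitaryGroup (Fin (n + 1)) ℂ,
      Measure.map (fun z => (U : Matrix (Fin (n + 1)) (Fin (n + 1)) ℂ).mulVec z) ν = ν) :
    μ = ν := by
  have key : ∀ t : ℝ, ∫ z, Complex.exp ((t * auxB (Pi.single 0 1) z : ℝ) * Complex.I) ∂μ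
      = ∫ z, Complex.exp ((t * auxB (Pi.single 0 1) z : ℝ) * Complex.I) ∂ν := by
    intro t
    have h1 : ∫ w, ∫ z, Complex.exp ((t * auxB w z : ℝ) * Complex.I) ∂μ ∂ν
        = ∫ z, Complex.exp ((t * auxB (Pi.single 0 1) z : ℝ) * Complex.I) ∂μ := by
      rw [integral_congr_ae (hνs.mono fun w hw => aux_char_const μ hμ t w hw)]
      simp
    have h2 : ∫ z, ∫ w, Complex.exp ((t * auxB w z : ℝ) * Complex.I) ∂ν ∂μ
        = ∫ z, Complex.exp ((t * auxB (Pi.single 0 1) z : ℝ) * Complex.I) ∂ν := by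
      simp_rw [fun w z => auxB_comm (m := n + 1) w z]
      rw [integral_congr_ae (hμs.mono fun w hw => aux_char_const ν hν t w hw)]
      simp [auxB_comm (Pi.single 0 1)]
    rw [← h1, ← h2]
    apply integral_integral_swap
    have hc := auxB_cont (m := n + 1)
    refine Integrable.of_bound (C := 1) ?_ ?_
    · apply Continuous.aestronglyMeasurable
      simp only [Function.uncurry_def]
      fun_prop
    · refine Filter.Eventually.of_forall fun p => ?_
      simp only [Function.uncurry_def]
      rw [Complex.norm_exp_ofReal_mul_I]
  apply Measure.ext_of_charFunDual
  ext L
  obtain ⟨w, hw⟩ := auxB_dual L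
  rw [charFunDual_apply, charFunDual_apply]
  simp_rw [hw]
  by_cases h0 : ∑ k, ‖w k‖ ^ 2 = 0
  · have : w = 0 := by
      ext k
      have := (Finset.sum_eq_zero_iff_of_nonneg (fun i _ => by positivity)).1 h0 k (Finset.mem_univ k)
      simpa using this
    subst this
    simp [auxB]
  · have hpos : 0 < ∑ k, ‖w k‖ ^ 2 :=
      lt_of_le_of_ne (Finset.sum_nonneg fun i _ => by positivity) (Ne.symm h0)
    set t := Real.sqrt (∑ k, ‖w k‖ ^ 2) with ht
    have htp : 0 < t := Real.sqrt_pos.2 hpos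
    have hw' : w = t • (t⁻¹ • w) := by
      rw [smul_smul, mul_inv_cancel₀ htp.ne', one_smul]
    have hu : ∑ k, ‖(t⁻¹ • w) k‖ ^ 2 = 1 := by
      simp only [Pi.smul_apply, norm_smul, mul_pow, ← Finset.mul_sum]
      rw [Real.norm_eq_abs, sq_abs, inv_pow, ht, Real.sq_sqrt hpos.le, inv_mul_cancel₀ hpos.ne']
    have hB : ∀ z, auxB w z = t * auxB (t⁻¹ • w) z := fun z => by
      rw [← auxB_smul, ← hw']
    simp_rw [hB]
    rw [aux_char_const μ hμ t _ hu, aux_char_const ν hν t _ hu, key]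

/-- Gaussian measure on `ℂ^m` -/
noncomputable def auxG (m : ℕ) : Measure (Fin m → ℂ) :=
  volume.withDensity fun z => ENNReal.ofReal (Real.exp (-∑ k, Real.pi * ‖z k‖ ^ 2))

lemma auxG_lintegral (m : ℕ) (F : (Fin m → ℝ) → ℝ≥0∞) (hF : Measurable F) :
    ∫⁻ z, F (fun k => Real.pi * ‖z k‖ ^ 2) ∂(auxG m)
      = ∫⁻ x in Set.univ.pi fun _ => Set.Ioi 0, ENNReal.ofReal (Real.exp (-∑ i, x i)) * F x := by
  unfold auxG
  rw [lintegral_withDensity_eq_lintegral_mul _ (by fun_prop) (by fun_prop), ← aux_map_pi,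
    lintegral_map (by fun_prop) (by fun_prop)]
  rfl

instance auxG_prob (m : ℕ) : IsProbabilityMeasure (auxG m) := by
  constructor
  have := auxG_lintegral m (fun _ => 1) measurable_const
  simp only [mul_one] at this
  rw [aux_mass] at this
  simpa using this

lemma auxG_inv {m : ℕ} (U : Matrix.unitaryGroup (Fin m) ℂ) :
    Measure.map (fun z => (U : Matrix (Fin m) (Fin m) ℂ).mulVec z) (auxG m) = auxG m := by
  set M : Matrix (Fin m) (Fin m) ℂ := (U : Matrix (Fin m) (Fin m) ℂ) with hM
  have hUm : Measurable fun z : Fin m → ℂ => M.mulVec z :=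
    (Continuous.matrix_mulVec continuous_const continuous_id).measurable
  set l : (Fin m → ℂ) →ₗ[ℝ] (Fin m → ℂ) := (Matrix.mulVecLin M).restrictScalars ℝ with hl
  set l' : (Fin m → ℂ) →ₗ[ℝ] (Fin m → ℂ) := (Matrix.mulVecLin (star M)).restrictScalars ℝ with hl'
  have hll : l' ∘ₗ l = LinearMap.id := by
    refine LinearMap.ext fun z => ?_
    have : star M * M = 1 := Matrix.UnitaryGroup.star_mul_self U
    simp [hl, hl', Matrix.mulVec_mulVec, this]
  have hdet : LinearMap.det l ≠ 0 := by
    intro h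
    have := congrArg LinearMap.det hll
    rw [LinearMap.det_comp, h] at this
    simp at this
  obtain ⟨c, hc⟩ : ∃ c : ℝ≥0∞, Measure.map (fun z => M.mulVec z) volume
      = c • (volume : Measure (Fin m → ℂ)) :=
    ⟨_, Measure.map_linearMap_addHaar_eq_smul_addHaar volume hdet⟩
  have hmap : Measure.map (fun z => M.mulVec z) (auxG m) = c • auxG m := by
    refine Measure.ext_of_lintegral _ fun f hf => ?_
    rw [lintegral_map hf hUm, lintegral_smul_measure]
    unfold auxG
    rw [lintegral_withDensity_eq_lintegral_mul _ (by fun_prop) (by fun_prop),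
      lintegral_withDensity_eq_lintegral_mul _ (by fun_prop) (by fun_prop),
      ← lintegral_smul_measure, ← hc, lintegral_map (by fun_prop) hUm]
    refine lintegral_congr fun z => ?_
    simp only [Pi.mul_apply, ← Finset.mul_sum]
    rw [hM, aux_unitary_sum U z]
  have hc1 : c = 1 := by
    have h := congrArg (fun ρ => ρ Set.univ) hmap
    rw [Measure.map_apply hUm MeasurableSet.univ] at h
    simpa using h.symm
  rw [hmap, hc1, one_smul]

/-- radial projection -/
noncomputable def auxN {m : ℕ} (z : Fin m → ℂ) : Fin m → ℂ :=
  (Real.sqrt (∑ k, ‖z k‖ ^ 2))⁻¹ • z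

lemma auxN_meas {m : ℕ} : Measurable (auxN (m := m)) := by
  unfold auxN
  fun_prop

lemma auxN_mulVec {m : ℕ} (U : Matrix.unitaryGroup (Fin m) ℂ) (z : Fin m → ℂ) :
    auxN ((U : Matrix (Fin m) (Fin m) ℂ).mulVec z)
      = (U : Matrix (Fin m) (Fin m) ℂ).mulVec (auxN z) := by
  unfold auxN
  rw [aux_unitary_sum, Matrix.mulVec_smul]

lemma auxN_sq {m : ℕ} (z : Fin m → ℂ) (k : Fin m) :
    ‖auxN z k‖ ^ 2 = ‖z k‖ ^ 2 / ∑ j, ‖z j‖ ^ 2 := by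
  unfold auxN
  rw [Pi.smul_apply, norm_smul, mul_pow, Real.norm_eq_abs, sq_abs, inv_pow,
    Real.sq_sqrt (Finset.sum_nonneg fun i _ => by positivity), div_eq_inv_mul]

lemma aux_sum_ne {m : ℕ} (z : Fin m → ℂ) (hz : z ≠ 0) : ∑ k, ‖z k‖ ^ 2 ≠ 0 := by
  intro h0
  apply hz
  ext k
  have := (Finset.sum_eq_zero_iff_of_nonneg (fun i _ => by positivity)).1 h0 k (Finset.mem_univ k)
  simpa using this

/-- if `z` is distributed according to the unitarily invariant (Fubini–Study)
probability measure on the unit sphere of `ℂ^{n+1}` — formalized as: `μ` is a probability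
measure concentrated on the unit sphere and invariant under every unitary — then
`(|z₀|², …, |z_n|²)/∑|z_k|²` is uniformly distributed on the standard simplex `Δ_n`, the latter
uniform probability measure being the pushforward of `n! ⬝ Lebesgue` on
`{y ∈ ℝ^n_{≥0} : ∑ y ≤ 1}` under `y ↦ (1 - ∑ y, y)`. -/
theorem stmt_11 (n : ℕ) (μ : Measure (Fin (n + 1) → ℂ)) [IsProbabilityMeasure μ]
    (hsphere : μ {z | ∑ k, ‖z k‖ ^ 2 = 1}ᶜ = 0)
    (hinv : ∀ U : Matrix.unitaryGroup (Fin (n + 1)) ℂ,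
      Measure.map (fun z => (U : Matrix (Fin (n + 1)) (Fin (n + 1)) ℂ).mulVec z) μ = μ) :
    Measure.map (fun z k => ‖z k‖ ^ 2 / ∑ j, ‖z j‖ ^ 2) μ
      = (Nat.factorial n : ℝ≥0∞) •
          Measure.map (fun y : Fin n → ℝ => Fin.cons (1 - ∑ i, y i) y)
            (volume.restrict {y : Fin n → ℝ | (∀ i, 0 ≤ y i) ∧ ∑ i, y i ≤ 1}) := by
  have hP : Measurable (fun (z : Fin (n + 1) → ℂ) k => ‖z k‖ ^ 2 / ∑ j, ‖z j‖ ^ 2) := by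
    fun_prop
  have hμν : μ = Measure.map auxN (auxG (n + 1)) := by
    have : IsProbabilityMeasure (Measure.map auxN (auxG (n + 1))) :=
      Measure.isProbabilityMeasure_map auxN_meas.aemeasurable
    refine aux_unique μ _ (by rw [ae_iff]; exact hsphere) ?_ hinv ?_
    · rw [ae_map_iff auxN_meas.aemeasurable (measurableSet_eq_fun (by fun_prop) (by fun_prop))]
      have hac : auxG (n + 1) ≪ volume := withDensity_absolutelyContinuous _ _
      filter_upwards [hac.ae_le (Measure.ae_ne volume (0 : Fin (n + 1) → ℂ))] with z hz
      simp_rw [auxN_sq]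
      rw [← Finset.sum_div, div_self (aux_sum_ne z hz)]
    · intro U
      have hUm : Measurable fun z : Fin (n + 1) → ℂ =>
          (U : Matrix (Fin (n + 1)) (Fin (n + 1)) ℂ).mulVec z :=
        (Continuous.matrix_mulVec continuous_const continuous_id).measurable
      conv_rhs => rw [← auxG_inv U]
      rw [Measure.map_map hUm auxN_meas, Measure.map_map auxN_meas hUm]
      congr 1
      ext1 z
      exact (auxN_mulVec U z).symm
  have hcons : Measurable (fun y : Fin n → ℝ => (Fin.cons (1 - ∑ i, y i) y : Fin (n + 1) → ℝ)) := by
    refine measurable_pi_lambda _ fun i => ?_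
    refine Fin.cases ?_ (fun j => ?_) i
    · simp only [Fin.cons_zero]; fun_prop
    · simp only [Fin.cons_succ]; fun_prop
  refine Measure.ext_of_lintegral _ fun f hf => ?_
  rw [lintegral_map hf hP, hμν, lintegral_map (by fun_prop) auxN_meas, lintegral_smul_measure,
    lintegral_map hf hcons, smul_eq_mul, ← aux_simplex n f hf,
    ← auxG_lintegral (n + 1) (fun x => f fun k => x k / ∑ j, x j) (by fun_prop)]
  have hac : auxG (n + 1) ≪ volume := withDensity_absolutelyContinuous _ _
  refine lintegral_congr_ae ?_
  filter_upwards [hac.ae_le (Measure.ae_ne volume (0 : Fin (n + 1) → ℂ))] with z hz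
  congr 1
  ext k
  simp_rw [auxN_sq]
  rw [← Finset.sum_div, div_self (aux_sum_ne z hz), ← Finset.mul_sum,
    mul_div_mul_left _ _ Real.pi_ne_zero, div_one]
end

section
/- Let ψ be a Haar-random pure state of two qubits (a unit vector in ℂ² ⊗ ℂ² chosen uniformly on the unit sphere). Then the maximal eigenvalues of the two one-body reduced density matrices are almost surely equal, and their common value s ∈ [1/2, 1] has probability density 24 (s − 1/2)² with respect to Lebesgue measure on [1/2, 1]. -/
open scoped BigOperators ENNReal
open MeasureTheory

namespace Aux14

abbrev Idx := Fin 2 × Fin 2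
abbrev Pol := MvPolynomial (Idx ⊕ Idx) ℂ

/-- the vector of coordinates and conjugated coordinates -/
noncomputable def cc (z : Idx → ℂ) : Idx ⊕ Idx → ℂ := Sum.elim z (fun a => star (z a))

lemma continuous_cc : Continuous cc := by
  refine continuous_pi ?_
  rintro (a | a)
  · exact continuous_apply a
  · exact (continuous_apply a).star

noncomputable def ev (P : Pol) (z : Idx → ℂ) : ℂ := MvPolynomial.eval (cc z) P

lemma continuous_ev (P : Pol) : Continuous (ev P) :=
  (MvPolynomial.continuous_eval P).comp continuous_cc

lemma hasDerivAt_eval (c : ℝ → Idx ⊕ Idx → ℂ) (c' : Idx ⊕ Idx → ℂ) (t : ℝ)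
    (h : ∀ s, HasDerivAt (fun u => c u s) (c' s) t) (P : Pol) :
    HasDerivAt (fun u => MvPolynomial.eval (c u) P)
      (∑ s, c' s * MvPolynomial.eval (c t) (MvPolynomial.pderiv s P)) t := by
  induction P using MvPolynomial.induction_on with
  | C a => simpa using hasDerivAt_const t a
  | add p q hp hq =>
    simp only [map_add, mul_add, Finset.sum_add_distrib]
    exact hp.add hq
  | mul_X p s hp =>
    simp only [map_mul, MvPolynomial.eval_X, Derivation.leibniz, smul_eq_mul, map_add,
      MvPolynomial.pderiv_X]
    refine (hp.mul (h s)).congr_deriv ?_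
    simp only [mul_add, Finset.sum_add_distrib, Finset.sum_mul]
    rw [add_comm]
    congr 1
    · rw [Finset.sum_eq_single s]
      · simp; ring
      · intro b _ hb
        simp [hb.symm]
      · simp
    · exact Finset.sum_congr rfl fun _ _ => by ring

def sph : Set (Idx → ℂ) := {z | ∑ p, ‖z p‖ ^ 2 = 1}

lemma isCompact_sph : IsCompact sph := by
  refine (isCompact_closedBall (0 : Idx → ℂ) 1).of_isClosed_subset ?_ ?_
  · exact isClosed_eq (by fun_prop) continuous_const
  · intro z hz
    rw [mem_closedBall_zero_iff, pi_norm_le_iff_of_nonneg zero_le_one]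
    intro i
    have h1 : ‖z i‖ ^ 2 ≤ ∑ p, ‖z p‖ ^ 2 :=
      Finset.single_le_sum (f := fun p => ‖z p‖ ^ 2) (fun _ _ => by positivity) (Finset.mem_univ i)
    rw [show ∑ p, ‖z p‖ ^ 2 = 1 from hz] at h1
    nlinarith [norm_nonneg (z i)]

lemma sum_norm_unitary (U : Matrix.unitaryGroup Idx ℂ) (z : Idx → ℂ) :
    ∑ p, ‖((U : Matrix Idx Idx ℂ).mulVec z) p‖ ^ 2 = ∑ p, ‖z p‖ ^ 2 := by
  have key : ∀ w : Idx → ℂ, ((∑ p, ‖w p‖ ^ 2 : ℝ) : ℂ) = star w ⬝ᵥ w := by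
    intro w
    simp only [dotProduct, Complex.ofReal_sum, Pi.star_apply]
    refine Finset.sum_congr rfl fun p _ => ?_
    rw [Complex.star_def, ← Complex.normSq_eq_conj_mul_self, Complex.normSq_eq_norm_sq]
  have h : (star ((U : Matrix Idx Idx ℂ).mulVec z)) ⬝ᵥ ((U : Matrix Idx Idx ℂ).mulVec z)
      = star z ⬝ᵥ z := by
    rw [Matrix.star_mulVec, ← Matrix.dotProduct_mulVec, Matrix.mulVec_mulVec,
      ← Matrix.star_eq_conjTranspose]
    rw [(Matrix.mem_unitaryGroup_iff').1 U.2, Matrix.one_mulVec]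
  rw [← key, ← key] at h
  exact_mod_cast h

section
variable (μ : Measure (Idx → ℂ))

lemma integrable_of_cont [IsProbabilityMeasure μ] (hsphere : μ {z | ∑ p, ‖z p‖ ^ 2 = 1}ᶜ = 0)
    {E : Type*} [NormedAddCommGroup E] [SecondCountableTopology E]
    {f : (Idx → ℂ) → E} (hf : Continuous f) : Integrable f μ := by
  borelize E
  obtain ⟨C, hC⟩ := isCompact_sph.exists_bound_of_continuousOn hf.continuousOn
  refine Integrable.of_bound hf.aestronglyMeasurable C ?_
  have : ∀ᵐ z ∂μ, z ∈ sph := hsphere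
  filter_upwards [this] with z hz using hC z hz

lemma integral_unitary
    (hinv : ∀ U : Matrix.unitaryGroup (Fin 2 × Fin 2) ℂ,
      Measure.map (fun z => (U : Matrix (Fin 2 × Fin 2) (Fin 2 × Fin 2) ℂ).mulVec z) μ = μ)
    (U : Matrix.unitaryGroup Idx ℂ) {f : (Idx → ℂ) → ℂ} (hf : Continuous f) :
    ∫ z, f ((U : Matrix Idx Idx ℂ).mulVec z) ∂μ = ∫ z, f z ∂μ := by
  have hc : Continuous (fun z : Idx → ℂ => (U : Matrix Idx Idx ℂ).mulVec z) := by fun_prop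
  conv_rhs => rw [← hinv U]
  rw [integral_map hc.aemeasurable hf.aestronglyMeasurable]

attribute [local instance] Matrix.linftyOpNormedRing Matrix.linftyOpNormedAlgebra

lemma exp_mem (X : Matrix Idx Idx ℂ) (hX : X.conjTranspose = -X) (t : ℝ) :
    NormedSpace.exp (t • X) ∈ Matrix.unitaryGroup Idx ℂ := by
  rw [Matrix.mem_unitaryGroup_iff', Matrix.star_eq_conjTranspose, ← Matrix.exp_conjTranspose,
    Matrix.conjTranspose_smul, hX, ← Matrix.exp_add_of_commute]
  · simp
  · simp only [star_trivial, smul_neg]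
    exact (Commute.refl _).neg_left

lemma hasDerivAt_exp_mulVec (X : Matrix Idx Idx ℂ) (t : ℝ) (z : Idx → ℂ) (a : Idx) :
    HasDerivAt (fun u : ℝ => ((NormedSpace.exp (u • X)).mulVec z) a)
      ((X.mulVec ((NormedSpace.exp (t • X)).mulVec z)) a) t := by
  have h := hasDerivAt_exp_smul_const' (𝕂 := ℝ) X t
  let l : Matrix Idx Idx ℂ →ₗ[ℝ] ℂ :=
    { toFun := fun M => (M.mulVec z) a
      map_add' := fun M N => by simp [Matrix.add_mulVec]
      map_smul' := fun r M => by simp [Matrix.smul_mulVec] }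
  have h2 := (LinearMap.toContinuousLinearMap l).hasFDerivAt.comp_hasDerivAt t h
  rw [Matrix.mulVec_mulVec]
  exact h2

/-- the vector field of a matrix acting on a polynomial -/
noncomputable def fld (X : Matrix Idx Idx ℂ) (P : Pol) (z : Idx → ℂ) : ℂ :=
  ∑ s, cc (X.mulVec z) s * MvPolynomial.eval (cc z) (MvPolynomial.pderiv s P)

lemma continuous_fld (X : Matrix Idx Idx ℂ) (P : Pol) : Continuous (fld X P) := by
  unfold fld
  refine continuous_finsetSum _ fun s _ => Continuous.mul ?_ ?_
  · exact (continuous_apply s).comp (continuous_cc.comp (by fun_prop))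
  · exact continuous_ev _

lemma integral_fld [IsProbabilityMeasure μ] (hsphere : μ {z | ∑ p, ‖z p‖ ^ 2 = 1}ᶜ = 0)
    (hinv : ∀ U : Matrix.unitaryGroup (Fin 2 × Fin 2) ℂ,
      Measure.map (fun z => (U : Matrix (Fin 2 × Fin 2) (Fin 2 × Fin 2) ℂ).mulVec z) μ = μ)
    (X : Matrix Idx Idx ℂ) (hX : X.conjTranspose = -X) (P : Pol) :
    ∫ z, fld X P z ∂μ = 0 := by
  obtain ⟨C, hC⟩ := isCompact_sph.exists_bound_of_continuousOn (continuous_fld X P).continuousOn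
  have hs : ∀ᵐ z ∂μ, z ∈ sph := hsphere
  have main := (hasDerivAt_integral_of_dominated_loc_of_deriv_le (μ := μ) (𝕜 := ℝ) (x₀ := 0)
    (s := Set.univ) (bound := fun _ => C)
    (F := fun t z => ev P ((NormedSpace.exp (t • X)).mulVec z))
    (F' := fun t z => fld X P ((NormedSpace.exp (t • X)).mulVec z))
    Filter.univ_mem ?_ ?_ ?_ ?_ (integrable_const C) ?_).2
  · have hconst : (fun t : ℝ => ∫ z, ev P ((NormedSpace.exp (t • X)).mulVec z) ∂μ)
        = fun _ => ∫ z, ev P z ∂μ := by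
      funext t
      exact integral_unitary μ hinv ⟨_, exp_mem X hX t⟩ (continuous_ev P)
    rw [hconst] at main
    have := main.unique (hasDerivAt_const _ _)
    simpa using this
  · refine Filter.Eventually.of_forall fun t => Continuous.aestronglyMeasurable ?_
    exact (continuous_ev P).comp (by fun_prop)
  · exact integrable_of_cont μ hsphere ((continuous_ev P).comp (by fun_prop))
  · refine Continuous.aestronglyMeasurable ?_
    exact (continuous_fld X P).comp (by fun_prop)
  · filter_upwards [hs] with z hz t _
    refine hC _ ?_
    have := sum_norm_unitary ⟨_, exp_mem X hX t⟩ z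
    exact this.trans hz
  · refine Filter.Eventually.of_forall fun z t _ => ?_
    refine hasDerivAt_eval (fun u => cc ((NormedSpace.exp (u • X)).mulVec z)) _ t ?_ P
    rintro (a | a)
    · exact hasDerivAt_exp_mulVec X t z a
    · exact (hasDerivAt_exp_mulVec X t z a).star

/-- infinitesimal invariance, complexified -/
lemma integral_gen [IsProbabilityMeasure μ] (hsphere : μ {z | ∑ p, ‖z p‖ ^ 2 = 1}ᶜ = 0)
    (hinv : ∀ U : Matrix.unitaryGroup (Fin 2 × Fin 2) ℂ,
      Measure.map (fun z => (U : Matrix (Fin 2 × Fin 2) (Fin 2 × Fin 2) ℂ).mulVec z) μ = μ)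
    (i j : Idx) (P : Pol) :
    ∫ z, ev (MvPolynomial.X (Sum.inl i) * MvPolynomial.pderiv (Sum.inl j) P
      - MvPolynomial.X (Sum.inr j) * MvPolynomial.pderiv (Sum.inr i) P) z ∂μ = 0 := by
  set A : Idx → Idx → (Idx → ℂ) → ℂ := fun i j => ev (MvPolynomial.X (Sum.inl i) * MvPolynomial.pderiv (Sum.inl j) P
      - MvPolynomial.X (Sum.inr j) * MvPolynomial.pderiv (Sum.inr i) P) with hA
  have hint : ∀ i j, Integrable (A i j) μ := fun i j => integrable_of_cont μ hsphere (continuous_ev _)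
  have key : ∀ ω : ℂ, ω * ∫ z, A i j z ∂μ - star ω * ∫ z, A j i z ∂μ = 0 := by
    intro ω
    have h := integral_fld μ hsphere hinv (Matrix.single j i ω - Matrix.single i j (star ω))
      (by simp [Matrix.conjTranspose_single]) P
    rw [← integral_const_mul, ← integral_const_mul, ← integral_sub, ← h]
    · refine integral_congr_ae (Filter.Eventually.of_forall fun z => ?_)
      simp only [hA, fld, ev, Fintype.sum_sum_type, cc, Sum.elim_inl, Sum.elim_inr, map_sub, map_mul,
        MvPolynomial.eval_X, Matrix.sub_mulVec, Pi.sub_apply, Matrix.single_mulVec, star_sub,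
        sub_mul, Finset.sum_sub_distrib, Function.update_apply, Pi.zero_apply, ite_mul, zero_mul,
        apply_ite star, star_zero, Finset.sum_ite_eq', Finset.mem_univ, if_true,
        star_mul', star_star]
      ring
    · exact (hint i j).const_mul _
    · exact (hint j i).const_mul _
  have h1 := key 1
  have h2 := key Complex.I
  simp only [star_one, one_mul, Complex.star_def, Complex.conj_I] at h1 h2
  have h3 : Complex.I * (2 * ∫ z, A i j z ∂μ) = 0 := by linear_combination h2 + Complex.I * h1
  simpa using h3

end

end Aux14
namespace Aux14

lemma perm_integral (μ : Measure (Idx → ℂ))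
    (hinv : ∀ U : Matrix.unitaryGroup (Fin 2 × Fin 2) ℂ,
      Measure.map (fun z => (U : Matrix (Fin 2 × Fin 2) (Fin 2 × Fin 2) ℂ).mulVec z) μ = μ)
    (σ : Equiv.Perm Idx) {f : (Idx → ℂ) → ℂ} (hf : Continuous f) :
    ∫ z, f (z ∘ σ) ∂μ = ∫ z, f z ∂μ := by
  have hU : σ.permMatrix ℂ ∈ Matrix.unitaryGroup Idx ℂ := by
    rw [Matrix.mem_unitaryGroup_iff, Matrix.star_eq_conjTranspose, Matrix.conjTranspose_permMatrix,
      ← Matrix.permMatrix_mul]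
    simp
  have := integral_unitary μ hinv ⟨_, hU⟩ hf
  simpa [Matrix.permMatrix_mulVec] using this

open MvPolynomial in
noncomputable def Dp : Pol := X (Sum.inl (0, 0)) * X (Sum.inl (1, 1)) - X (Sum.inl (0, 1)) * X (Sum.inl (1, 0))
open MvPolynomial in
noncomputable def Db : Pol := X (Sum.inr (0, 0)) * X (Sum.inr (1, 1)) - X (Sum.inr (0, 1)) * X (Sum.inr (1, 0))

open MvPolynomial in
lemma poly_identity (k : ℕ) :
    ∑ i : Idx, (X (Sum.inl i) * pderiv (Sum.inl (0, 0)) (X (Sum.inr i) * (X (Sum.inr (1, 1)) * Dp ^ (k + 1) * Db ^ k))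
      - X (Sum.inr (0, 0)) * pderiv (Sum.inr i) (X (Sum.inr i) * (X (Sum.inr (1, 1)) * Dp ^ (k + 1) * Db ^ k)))
    = ((k : Pol) + 1) * (∑ i : Idx, X (Sum.inl i) * X (Sum.inr i)) * (X (Sum.inl (1, 1)) * X (Sum.inr (1, 1)) * Dp ^ k * Db ^ k)
      - (2 * (k : Pol) + 5) * (X (Sum.inr (0, 0)) * X (Sum.inr (1, 1)) * Dp ^ (k + 1) * Db ^ k) := by
  have hk : (k : Pol) * Db ^ (k - 1) * Db = k * Db ^ k := by
    cases k with
    | zero => simp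
    | succ n => rw [Nat.add_sub_cancel, pow_succ]; ring
  have e1 : ∀ s, pderiv s Dp = pderiv s (X (Sum.inl (0, 0)) * X (Sum.inl (1, 1)) - X (Sum.inl (0, 1)) * X (Sum.inl (1, 0)) : Pol) := fun s => rfl
  have e2 : ∀ s, pderiv s Db = pderiv s (X (Sum.inr (0, 0)) * X (Sum.inr (1, 1)) - X (Sum.inr (0, 1)) * X (Sum.inr (1, 0)) : Pol) := fun s => rfl
  have e3 : Db = (X (Sum.inr (0, 0)) * X (Sum.inr (1, 1)) - X (Sum.inr (0, 1)) * X (Sum.inr (1, 0)) : Pol) := rfl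
  simp only [Fintype.sum_prod_type, Fin.sum_univ_two, Derivation.leibniz, Derivation.leibniz_pow, e1, e2,
    map_sub, pderiv_X, Pi.single_apply, smul_eq_mul, nsmul_eq_mul, Nat.add_sub_cancel]
  simp [Prod.ext_iff]
  rw [pow_succ]
  have hk2 : (k : Pol) * Db ^ (k - 1) *
      (X (Sum.inr (0, 0)) * X (Sum.inr (1, 1)) - X (Sum.inr (0, 1)) * X (Sum.inr (1, 0))) = (k : Pol) * Db ^ k := hk
  linear_combination (-2 * X (Sum.inr (0, 0)) * X (Sum.inr (1, 1)) * Dp ^ k * Dp) * hk2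

/-- the squared modulus of the determinant -/
noncomputable def dsq (z : Idx → ℂ) : ℝ := ‖z (0, 0) * z (1, 1) - z (0, 1) * z (1, 0)‖ ^ 2

lemma continuous_dsq : Continuous dsq := by unfold dsq; fun_prop

/-- swap of columns -/
def swC : Equiv.Perm Idx := Equiv.prodCongr (Equiv.refl _) (Equiv.swap 0 1)
/-- swap of rows -/
def swR : Equiv.Perm Idx := Equiv.prodCongr (Equiv.swap 0 1) (Equiv.refl _)

lemma ev_Dp (z : Idx → ℂ) : ev Dp z = z (0, 0) * z (1, 1) - z (0, 1) * z (1, 0) := by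
  simp [ev, Dp, cc]

lemma ev_Db (z : Idx → ℂ) : ev Db z = star (ev Dp z) := by
  simp [ev, Db, Dp, cc]

lemma ev_Dp_mul (z : Idx → ℂ) : ev Dp z * ev Db z = (dsq z : ℂ) := by
  rw [ev_Db, ev_Dp, Complex.star_def, Complex.mul_conj, Complex.normSq_eq_norm_sq, dsq]

lemma ev_mul (P Q : Pol) (z) : ev (P * Q) z = ev P z * ev Q z := by simp [ev]
lemma ev_pow (P : Pol) (n : ℕ) (z) : ev (P ^ n) z = ev P z ^ n := by simp [ev]

lemma swC_Dp (z : Idx → ℂ) : ev Dp (z ∘ swC) = - ev Dp z := by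
  rw [ev_Dp, ev_Dp]; simp [swC]
lemma swR_Dp (z : Idx → ℂ) : ev Dp (z ∘ swR) = - ev Dp z := by
  rw [ev_Dp, ev_Dp]; simp [swR]; ring
lemma swC_dsq (z : Idx → ℂ) : dsq (z ∘ swC) = dsq z := by
  unfold dsq; rw [← ev_Dp, ← ev_Dp, swC_Dp, norm_neg]
lemma swR_dsq (z : Idx → ℂ) : dsq (z ∘ swR) = dsq z := by
  unfold dsq; rw [← ev_Dp, ← ev_Dp, swR_Dp, norm_neg]

lemma step1
    (μ : Measure (Idx → ℂ)) [IsProbabilityMeasure μ]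
    (hsphere : μ {z | ∑ p, ‖z p‖ ^ 2 = 1}ᶜ = 0)
    (hinv : ∀ U : Matrix.unitaryGroup (Fin 2 × Fin 2) ℂ,
      Measure.map (fun z => (U : Matrix (Fin 2 × Fin 2) (Fin 2 × Fin 2) ℂ).mulVec z) μ = μ)
    (k : ℕ) :
    (2 * (k : ℂ) + 5) * ∫ z, star (z (0, 0)) * star (z (1, 1)) * ev Dp z ^ (k + 1) * ev Db z ^ k ∂μ
    = ((k : ℂ) + 1) * ∫ z, z (1, 1) * star (z (1, 1)) * (dsq z : ℂ) ^ k ∂μ := by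
  have h0 : ∫ z, ev (∑ i : Idx, (MvPolynomial.X (Sum.inl i) * MvPolynomial.pderiv (Sum.inl (0, 0)) (MvPolynomial.X (Sum.inr i) * (MvPolynomial.X (Sum.inr (1, 1)) * Dp ^ (k + 1) * Db ^ k))
      - MvPolynomial.X (Sum.inr (0, 0)) * MvPolynomial.pderiv (Sum.inr i) (MvPolynomial.X (Sum.inr i) * (MvPolynomial.X (Sum.inr (1, 1)) * Dp ^ (k + 1) * Db ^ k)))) z ∂μ = 0 := by
    have e : ∀ (f : Idx → Pol) z, ev (∑ i, f i) z = ∑ i, ev (f i) z := by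
      intro f z; simp [ev]
    simp only [e]
    rw [integral_finsetSum]
    · exact Finset.sum_eq_zero fun i _ => integral_gen μ hsphere hinv i (0, 0) _
    · exact fun i _ => integrable_of_cont μ hsphere (continuous_ev _)
  rw [poly_identity] at h0
  have hs : ∀ᵐ z ∂μ, z ∈ sph := hsphere
  rw [← integral_const_mul, ← integral_const_mul, ← sub_eq_zero, ← integral_sub, ← neg_eq_zero,
    ← integral_neg, ← h0]
  · refine integral_congr_ae ?_
    filter_upwards [hs] with z hz
    have hN : ∑ i : Idx, z i * star (z i) = 1 := by
      have hz' : ∑ p, ‖z p‖ ^ 2 = 1 := hz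
      have : ((∑ p, ‖z p‖ ^ 2 : ℝ) : ℂ) = 1 := by rw [hz']; simp
      rw [← this, Complex.ofReal_sum]
      refine Finset.sum_congr rfl fun p _ => ?_
      rw [Complex.star_def, Complex.mul_conj, Complex.normSq_eq_norm_sq]
    rw [← ev_Dp_mul]
    simp only [ev, map_sub, map_mul, map_add, map_sum, map_pow, MvPolynomial.eval_X, cc, Sum.elim_inl,
      Sum.elim_inr, map_natCast, map_one, map_ofNat] at hN ⊢
    rw [hN]
    ring
  · exact integrable_of_cont μ hsphere (by have := continuous_ev Dp; have := continuous_ev Db; fun_prop)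
  · exact integrable_of_cont μ hsphere (by have := continuous_dsq; fun_prop)

lemma step2
    (μ : Measure (Idx → ℂ)) [IsProbabilityMeasure μ]
    (hsphere : μ {z | ∑ p, ‖z p‖ ^ 2 = 1}ᶜ = 0)
    (hinv : ∀ U : Matrix.unitaryGroup (Fin 2 × Fin 2) ℂ,
      Measure.map (fun z => (U : Matrix (Fin 2 × Fin 2) (Fin 2 × Fin 2) ℂ).mulVec z) μ = μ)
    (k : ℕ) :
    ∫ z, ((dsq z : ℂ)) ^ (k + 1) ∂μ
      = 2 * ∫ z, star (z (0, 0)) * star (z (1, 1)) * ev Dp z ^ (k + 1) * ev Db z ^ k ∂μ := by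
  have c1 := continuous_ev Dp
  have c2 := continuous_ev Db
  obtain ⟨f, hf⟩ : ∃ f : (Idx → ℂ) → ℂ, f = fun z =>
      star (z (0, 0)) * star (z (1, 1)) * ev Dp z ^ (k + 1) * ev Db z ^ k := ⟨_, rfl⟩
  have c4 : Continuous f := by
    rw [hf]
    fun_prop
  have hp := perm_integral μ hinv swC c4
  have hgoal : ∫ z, ((dsq z : ℂ)) ^ (k + 1) ∂μ = ∫ z, f z ∂μ + ∫ z, f (z ∘ swC) ∂μ := by
    rw [← integral_add]
    rotate_left
    · exact integrable_of_cont μ hsphere c4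
    · refine integrable_of_cont μ hsphere ?_
      have c3 : Continuous fun z : Idx → ℂ => z ∘ swC :=
        continuous_pi fun p => continuous_apply (swC p)
      exact Continuous.comp c4 c3
    refine integral_congr_ae (Filter.Eventually.of_forall fun z => ?_)
    simp only [hf, ← ev_Dp_mul, ev_Db, swC_Dp]
    have : star (ev Dp z) = star (z (0, 0)) * star (z (1, 1)) - star (z (0, 1)) * star (z (1, 0)) := by
      rw [ev_Dp]; simp
    have h1 : (-ev Dp z) ^ (k + 1) * (star (-ev Dp z)) ^ k = - (ev Dp z ^ (k + 1) * (star (ev Dp z)) ^ k) := by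
      rw [star_neg, neg_pow, neg_pow (star _)]
      have : ((-1 : ℂ)) ^ (k + 1) * (-1) ^ k = -1 := by
        rw [← pow_add]; exact Odd.neg_one_pow ⟨k, by ring⟩
      linear_combination (ev Dp z ^ (k + 1) * (star (ev Dp z)) ^ k) * this
    simp only [swC, Function.comp, Equiv.prodCongr_apply, Prod.map, Equiv.refl_apply,
      Equiv.swap_apply_right, Equiv.swap_apply_left]
    rw [mul_assoc (_ * _) (_ ^ _), mul_assoc (_ * _) ((-_) ^ _), h1]
    rw [mul_pow, pow_succ (_ : ℂ)  k, pow_succ (_ : ℂ) k]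
    linear_combination (ev Dp z ^ k * ev Dp z * (star (ev Dp z)) ^ k) * this
  rw [hgoal, hp, hf, two_mul]

lemma step3
    (μ : Measure (Idx → ℂ)) [IsProbabilityMeasure μ]
    (hsphere : μ {z | ∑ p, ‖z p‖ ^ 2 = 1}ᶜ = 0)
    (hinv : ∀ U : Matrix.unitaryGroup (Fin 2 × Fin 2) ℂ,
      Measure.map (fun z => (U : Matrix (Fin 2 × Fin 2) (Fin 2 × Fin 2) ℂ).mulVec z) μ = μ)
    (k : ℕ) :
    ∫ z, ((dsq z : ℂ)) ^ k ∂μ = 4 * ∫ z, z (1, 1) * star (z (1, 1)) * (dsq z : ℂ) ^ k ∂μ := by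
  have c1 := continuous_dsq
  have hC := perm_integral μ hinv swC
    (f := fun z => z (1, 1) * star (z (1, 1)) * (dsq z : ℂ) ^ k) (by fun_prop)
  have hR := perm_integral μ hinv swR
    (f := fun z => z (1, 1) * star (z (1, 1)) * (dsq z : ℂ) ^ k) (by fun_prop)
  have hR2 := perm_integral μ hinv swR
    (f := fun z => z (1, 0) * star (z (1, 0)) * (dsq z : ℂ) ^ k) (by fun_prop)
  simp only [swC_dsq, swR_dsq] at hC hR hR2
  simp only [swC, swR, Function.comp, Equiv.prodCongr_apply, Prod.map, Equiv.refl_apply,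
    Equiv.swap_apply_right] at hC hR hR2
  have hs : ∀ᵐ z ∂μ, z ∈ sph := hsphere
  have hi : ∀ p : Idx, Integrable (fun z : Idx → ℂ => z p * star (z p) * (dsq z : ℂ) ^ k) μ := fun p =>
    integrable_of_cont μ hsphere (by fun_prop)
  have : ∫ z, ((dsq z : ℂ)) ^ k ∂μ = ∑ p : Idx, ∫ z, z p * star (z p) * (dsq z : ℂ) ^ k ∂μ := by
    rw [← integral_finsetSum _ fun p _ => hi p]
    refine integral_congr_ae ?_
    filter_upwards [hs] with z hz
    have hN : ∑ i : Idx, z i * star (z i) = 1 := by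
      have hz' : ∑ p, ‖z p‖ ^ 2 = 1 := hz
      have : ((∑ p, ‖z p‖ ^ 2 : ℝ) : ℂ) = 1 := by rw [hz']; simp
      rw [← this, Complex.ofReal_sum]
      refine Finset.sum_congr rfl fun p _ => ?_
      rw [Complex.star_def, Complex.mul_conj, Complex.normSq_eq_norm_sq]
    rw [← Finset.sum_mul, hN, one_mul]
  rw [this, Fintype.sum_prod_type, Fin.sum_univ_two, Fin.sum_univ_two, Fin.sum_univ_two, hR2, hC, hR]
  ring

lemma moment_rec
    (μ : Measure (Idx → ℂ)) [IsProbabilityMeasure μ]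
    (hsphere : μ {z | ∑ p, ‖z p‖ ^ 2 = 1}ᶜ = 0)
    (hinv : ∀ U : Matrix.unitaryGroup (Fin 2 × Fin 2) ℂ,
      Measure.map (fun z => (U : Matrix (Fin 2 × Fin 2) (Fin 2 × Fin 2) ℂ).mulVec z) μ = μ)
    (k : ℕ) :
    (2 * (k : ℝ) + 5) * ∫ z, dsq z ^ (k + 1) ∂μ = ((k : ℝ) + 1) / 2 * ∫ z, dsq z ^ k ∂μ := by
  have h1 := step1 μ hsphere hinv k
  have h2 := step2 μ hsphere hinv k
  have h3 := step3 μ hsphere hinv k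
  have e : ∀ n : ℕ, ∫ z, ((dsq z : ℂ)) ^ n ∂μ = ((∫ z, dsq z ^ n ∂μ : ℝ) : ℂ) := by
    intro n
    rw [← integral_complex_ofReal]
    simp
  rw [e] at h2 h3
  have : (2 * (k : ℂ) + 5) * ((∫ z, dsq z ^ (k + 1) ∂μ : ℝ) : ℂ)
      = ((k : ℂ) + 1) / 2 * ((∫ z, dsq z ^ k ∂μ : ℝ) : ℂ) := by
    linear_combination (2 * (k : ℂ) + 5) * h2 + 2 * h1 - ((k : ℂ) + 1) / 2 * h3
  apply Complex.ofReal_injective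
  push_cast
  exact this

end Aux14
namespace Aux14

lemma spec_set (M : Matrix (Fin 2) (Fin 2) ℂ) (T D : ℝ) (hT : M.trace = T) (hD : M.det = D) :
    {r : ℝ | (r : ℂ) ∈ spectrum ℂ M} = {r : ℝ | r ^ 2 - T * r + D = 0} := by
  ext r
  simp only [Set.mem_ofPred_eq, Matrix.mem_spectrum_iff_isRoot_charpoly, Matrix.charpoly_fin_two, hT, hD,
    Polynomial.IsRoot.def, Polynomial.eval_add, Polynomial.eval_sub, Polynomial.eval_mul,
    Polynomial.eval_pow, Polynomial.eval_X, Polynomial.eval_C]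
  exact_mod_cast Iff.rfl

/-- larger root of `r ^ 2 - r + D` -/
noncomputable def hroot (D : ℝ) : ℝ := (1 + √(1 - 4 * D)) / 2

lemma measurable_hroot : Measurable hroot := by
  have : Continuous hroot := by unfold hroot; fun_prop
  exact this.measurable

lemma sSup_root (D : ℝ) (hD : D ≤ 1 / 4) : sSup {r : ℝ | r ^ 2 - 1 * r + D = 0} = hroot D := by
  have h := Real.sq_sqrt (show 0 ≤ 1 - 4 * D by linarith)
  have h0 := Real.sqrt_nonneg (1 - 4 * D)
  refine IsGreatest.csSup_eq ⟨?_, ?_⟩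
  · simp only [Set.mem_ofPred_eq, hroot]; nlinarith
  · intro r hr
    simp only [Set.mem_ofPred_eq] at hr
    unfold hroot
    have : 2 * r - 1 ≤ √(1 - 4 * D) := Real.le_sqrt_of_sq_le (by nlinarith)
    linarith

lemma normsq_cast (w : ℂ) : ((‖w‖ ^ 2 : ℝ) : ℂ) = w * star w := by
  rw [Complex.star_def, Complex.mul_conj, Complex.normSq_eq_norm_sq]

lemma spec1 (z : Idx → ℂ) : {r : ℝ | (r : ℂ) ∈ spectrum ℂ
          (Matrix.of fun i j : Fin 2 => ∑ m : Fin 2, z (i, m) * star (z (j, m)))}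
    = {r : ℝ | r ^ 2 - (∑ p, ‖z p‖ ^ 2) * r + dsq z = 0} := by
  refine spec_set _ _ _ ?_ ?_
  · rw [Complex.ofReal_sum]
    simp only [normsq_cast, Fintype.sum_prod_type, Matrix.trace, Matrix.diag, Matrix.of_apply]
  · rw [dsq, normsq_cast]
    simp only [Matrix.det_fin_two, Matrix.of_apply, Fin.sum_univ_two, star_sub, star_mul']
    ring

lemma spec2 (z : Idx → ℂ) : {r : ℝ | (r : ℂ) ∈ spectrum ℂ
          (Matrix.of fun i j : Fin 2 => ∑ m : Fin 2, z (m, i) * star (z (m, j)))}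
    = {r : ℝ | r ^ 2 - (∑ p, ‖z p‖ ^ 2) * r + dsq z = 0} := by
  refine spec_set _ _ _ ?_ ?_
  · rw [Complex.ofReal_sum]
    simp only [normsq_cast, Fintype.sum_prod_type, Matrix.trace, Matrix.diag, Matrix.of_apply,
      Fin.sum_univ_two]
    ring
  · rw [dsq, normsq_cast]
    simp only [Matrix.det_fin_two, Matrix.of_apply, Fin.sum_univ_two, star_sub, star_mul']
    ring

lemma dsq_mem {z : Idx → ℂ} (hz : z ∈ sph) : dsq z ∈ Set.Icc (0 : ℝ) (1 / 4) := by
  refine ⟨by unfold dsq; positivity, ?_⟩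
  have hz' : ∑ p, ‖z p‖ ^ 2 = 1 := hz
  simp only [Fintype.sum_prod_type, Fin.sum_univ_two] at hz'
  have h := norm_sub_le (z (0, 0) * z (1, 1)) (z (0, 1) * z (1, 0))
  rw [norm_mul, norm_mul] at h
  have h2 : ‖z (0, 0) * z (1, 1) - z (0, 1) * z (1, 0)‖ ≤ 1 / 2 := by
    nlinarith [sq_nonneg (‖z (0, 0)‖ - ‖z (1, 1)‖), sq_nonneg (‖z (0, 1)‖ - ‖z (1, 0)‖)]
  unfold dsq
  nlinarith [norm_nonneg (z (0, 0) * z (1, 1) - z (0, 1) * z (1, 0))]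

/-- two probability measures on a compact interval with equal moments agree -/
lemma ext_moments (α β : Measure ℝ) [IsProbabilityMeasure α] [IsProbabilityMeasure β] (a b : ℝ)
    (hα : ∀ᵐ x ∂α, x ∈ Set.Icc a b) (hβ : ∀ᵐ x ∂β, x ∈ Set.Icc a b)
    (h : ∀ n : ℕ, ∫ x, x ^ n ∂α = ∫ x, x ^ n ∂β) : α = β := by
  have hint : ∀ (γ : Measure ℝ) [IsProbabilityMeasure γ], (∀ᵐ x ∂γ, x ∈ Set.Icc a b) →
      ∀ f : ℝ → ℝ, Continuous f → Integrable f γ := by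
    intro γ _ hγ f hf
    obtain ⟨C, hC⟩ := (isCompact_Icc (a := a) (b := b)).exists_bound_of_continuousOn hf.continuousOn
    refine Integrable.of_bound hf.aestronglyMeasurable C ?_
    filter_upwards [hγ] with z hz using hC z hz
  have hpoly : ∀ p : Polynomial ℝ, ∫ x, p.eval x ∂α = ∫ x, p.eval x ∂β := by
    intro p
    simp only [Polynomial.eval_eq_sum_range]
    rw [integral_finsetSum, integral_finsetSum]
    · simp only [integral_const_mul, h]
    · exact fun i _ => hint β hβ _ (by fun_prop)
    · exact fun i _ => hint α hα _ (by fun_prop)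
  have happ : ∀ (γ : Measure ℝ) [IsProbabilityMeasure γ], (∀ᵐ x ∂γ, x ∈ Set.Icc a b) →
      ∀ (f : ℝ → ℝ), Continuous f → ∀ (p : Polynomial ℝ) (ε : ℝ),
      (∀ x ∈ Set.Icc a b, |p.eval x - f x| < ε) → |∫ x, p.eval x ∂γ - ∫ x, f x ∂γ| ≤ ε := by
    intro γ _ hγ f hf p ε hp
    rw [← integral_sub (hint γ hγ _ p.continuous) (hint γ hγ _ hf)]
    have := norm_integral_le_of_norm_le_const (μ := γ) (f := fun x => p.eval x - f x) (C := ε) (by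
      filter_upwards [hγ] with x hx using (hp x hx).le)
    simpa using this
  refine ext_of_forall_integral_eq_of_IsFiniteMeasure fun f => ?_
  refine eq_of_forall_dist_le fun ε hε => ?_
  obtain ⟨p, hp⟩ := exists_polynomial_near_of_continuousOn a b f f.continuous.continuousOn (ε / 2)
    (by positivity)
  have h1 := happ α hα f f.continuous p _ hp
  have h2 := happ β hβ f f.continuous p _ hp
  rw [hpoly p] at h1
  rw [Real.dist_eq]
  rw [abs_le] at *
  constructor <;> linarith [h1.1, h1.2, h2.1, h2.2]

/-- target measure -/
noncomputable def tgt : Measure ℝ := (volume.restrict (Set.Icc (1 / 2 : ℝ) 1)).withDensity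
            (fun s => ENNReal.ofReal (24 * (s - 1 / 2) ^ 2))

lemma tgt_ae : ∀ᵐ s ∂tgt, s ∈ Set.Icc (1 / 2 : ℝ) 1 :=
  (withDensity_absolutelyContinuous _ _).ae_le (ae_restrict_mem measurableSet_Icc)

lemma tgt_integral (g : ℝ → ℝ) :
    ∫ s, g s ∂tgt = ∫ s in (1 / 2 : ℝ)..1, 24 * (s - 1 / 2) ^ 2 * g s := by
  unfold tgt
  rw [integral_withDensity_eq_integral_toReal_smul (by fun_prop)
      (Filter.Eventually.of_forall fun _ => ENNReal.ofReal_lt_top),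
    intervalIntegral.integral_of_le (by norm_num), integral_Icc_eq_integral_Ioc]
  refine integral_congr_ae (Filter.Eventually.of_forall fun s => ?_)
  simp only [smul_eq_mul]
  rw [ENNReal.toReal_ofReal (by positivity)]

lemma poly_int : ∫ s in (1 / 2 : ℝ)..1, 24 * (s - 1 / 2) ^ 2 = 1 := by
  have := intervalIntegral.integral_eq_sub_of_hasDerivAt (a := 1 / 2) (b := 1)
    (f := fun s : ℝ => 8 * (s - 1 / 2) ^ 3) (f' := fun s => 24 * (s - 1 / 2) ^ 2) (fun x _ => by
      have := (((hasDerivAt_id x).sub_const (1 / 2)).pow 3).const_mul 8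
      refine this.congr_deriv ?_
      simp; ring) (Continuous.intervalIntegrable (by fun_prop) _ _)
  rw [this]; norm_num

instance : IsProbabilityMeasure tgt := by
  constructor
  unfold tgt
  rw [withDensity_apply _ MeasurableSet.univ, Measure.restrict_univ,
    ← ofReal_integral_eq_lintegral_ofReal]
  · rw [integral_Icc_eq_integral_Ioc, ← intervalIntegral.integral_of_le (by norm_num), poly_int]
    simp
  · exact (Continuous.integrableOn_Icc (by fun_prop))
  · exact Filter.Eventually.of_forall fun s => by positivity

lemma tgt_rec (k : ℕ) : (2 * (k : ℝ) + 5) * ∫ s, (s * (1 - s)) ^ (k + 1) ∂tgt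
    = ((k : ℝ) + 1) / 2 * ∫ s, (s * (1 - s)) ^ k ∂tgt := by
  rw [tgt_integral, tgt_integral, ← sub_eq_zero, ← intervalIntegral.integral_const_mul,
    ← intervalIntegral.integral_const_mul, ← intervalIntegral.integral_sub
      (Continuous.intervalIntegrable (by fun_prop) _ _)
      (Continuous.intervalIntegrable (by fun_prop) _ _)]
  rw [intervalIntegral.integral_eq_sub_of_hasDerivAt (a := 1 / 2) (b := 1)
    (f := fun s : ℝ => 24 * ((s - 1 / 2) ^ 3 * (s * (1 - s)) ^ (k + 1))) (fun x _ => ?_)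
    (Continuous.intervalIntegrable (by fun_prop) _ _)]
  · norm_num
  · have h1 := ((hasDerivAt_id x).sub_const (1 / 2)).pow 3
    have h2 := ((hasDerivAt_id x).mul ((hasDerivAt_id x).const_sub 1)).pow (k + 1)
    refine ((h1.mul h2).const_mul 24).congr_deriv ?_
    simp
    ring

lemma hroot_tgt {s : ℝ} (hs : s ∈ Set.Icc (1 / 2 : ℝ) 1) : hroot (s * (1 - s)) = s := by
  unfold hroot
  rw [show 1 - 4 * (s * (1 - s)) = (2 * s - 1) ^ 2 by ring, Real.sqrt_sq (by linarith [hs.1])]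
  ring

end Aux14

theorem stmt_14 (μ : Measure (Fin 2 × Fin 2 → ℂ)) [IsProbabilityMeasure μ]
    (hsphere : μ {z | ∑ p, ‖z p‖ ^ 2 = 1}ᶜ = 0)
    (hinv : ∀ U : Matrix.unitaryGroup (Fin 2 × Fin 2) ℂ,
      Measure.map (fun z => (U : Matrix (Fin 2 × Fin 2) (Fin 2 × Fin 2) ℂ).mulVec z) μ = μ) :
    (∀ᵐ z ∂μ,
      sSup {r : ℝ | (r : ℂ) ∈ spectrum ℂ
          (Matrix.of fun i j : Fin 2 => ∑ m : Fin 2, z (i, m) * star (z (j, m)))}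
        = sSup {r : ℝ | (r : ℂ) ∈ spectrum ℂ
          (Matrix.of fun i j : Fin 2 => ∑ m : Fin 2, z (m, i) * star (z (m, j)))})
    ∧ Measure.map (fun z => sSup {r : ℝ | (r : ℂ) ∈ spectrum ℂ
          (Matrix.of fun i j : Fin 2 => ∑ m : Fin 2, z (i, m) * star (z (j, m)))}) μ
        = (volume.restrict (Set.Icc (1 / 2 : ℝ) 1)).withDensity
            (fun s => ENNReal.ofReal (24 * (s - 1 / 2) ^ 2)) := by
  refine ⟨Filter.Eventually.of_forall fun z => ?_, ?_⟩
  · rw [Aux14.spec1, Aux14.spec2]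
  change _ = Aux14.tgt
  have hs : ∀ᵐ z ∂μ, z ∈ Aux14.sph := hsphere
  have hdm : Measurable Aux14.dsq := Aux14.continuous_dsq.measurable
  have hgc : Continuous (fun s : ℝ => s * (1 - s)) := by fun_prop
  have e1 : Measure.map (fun z => sSup {r : ℝ | (r : ℂ) ∈ spectrum ℂ
          (Matrix.of fun i j : Fin 2 => ∑ m : Fin 2, z (i, m) * star (z (j, m)))}) μ
      = Measure.map (Aux14.hroot ∘ Aux14.dsq) μ := by
    refine Measure.map_congr ?_
    filter_upwards [hs] with z hz
    rw [Aux14.spec1, show ∑ p, ‖z p‖ ^ 2 = 1 from hz, Aux14.sSup_root _ (Aux14.dsq_mem hz).2]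
    rfl
  have e2 : Measure.map (Aux14.hroot ∘ fun s : ℝ => s * (1 - s)) Aux14.tgt = Aux14.tgt := by
    have : Measure.map (Aux14.hroot ∘ fun s : ℝ => s * (1 - s)) Aux14.tgt
        = Measure.map id Aux14.tgt := by
      refine Measure.map_congr ?_
      filter_upwards [Aux14.tgt_ae] with s hs using Aux14.hroot_tgt hs
    rw [this, Measure.map_id]
  rw [e1, ← e2, ← Measure.map_map Aux14.measurable_hroot hdm,
    ← Measure.map_map Aux14.measurable_hroot hgc.measurable]
  congr 1
  have p1 : IsProbabilityMeasure (Measure.map Aux14.dsq μ) :=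
    Measure.isProbabilityMeasure_map hdm.aemeasurable
  have p2 : IsProbabilityMeasure (Measure.map (fun s : ℝ => s * (1 - s)) Aux14.tgt) :=
    Measure.isProbabilityMeasure_map hgc.measurable.aemeasurable
  refine Aux14.ext_moments _ _ 0 (1 / 4) ?_ ?_ fun n => ?_
  · refine (ae_map_iff (p := fun x => x ∈ Set.Icc (0 : ℝ) (1 / 4)) hdm.aemeasurable measurableSet_Icc).2 ?_
    filter_upwards [hs] with z hz using Aux14.dsq_mem hz
  · refine (ae_map_iff (p := fun x => x ∈ Set.Icc (0 : ℝ) (1 / 4)) hgc.measurable.aemeasurable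
      measurableSet_Icc).2 ?_
    filter_upwards [Aux14.tgt_ae] with s hs
    exact ⟨by nlinarith [hs.1, hs.2], by nlinarith [sq_nonneg (s - 1 / 2)]⟩
  · rw [integral_map hdm.aemeasurable (by fun_prop),
      integral_map hgc.measurable.aemeasurable (by fun_prop)]
    induction n with
    | zero => simp
    | succ k ih =>
      have h1 := Aux14.moment_rec μ hsphere hinv k
      have h2 := Aux14.tgt_rec k
      rw [ih, ← h2] at h1
      exact mul_left_cancel₀ (by positivity) h1
end

section
/- The expected value of the reduced purity ‖ρ₁‖₂² = λ_max² + (1 − λ_max)² of the one-body reduced density matrix of a Haar-random pure state in Sym^N(ℂ²) equals 1/2 + 1/(2N). -/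
open scoped BigOperators ENNReal
open MeasureTheory


noncomputable section
namespace Bos

/-- number of ones -/
def wt {n : ℕ} (f : Fin n → Fin 2) : ℕ := ∑ i, (f i : ℕ)

lemma wt_cons {n : ℕ} (i : Fin 2) (g : Fin n → Fin 2) :
    wt (Fin.cons i g : Fin (n+1) → Fin 2) = (i : ℕ) + wt g := by
  simp [wt, Fin.sum_univ_succ]

lemma wt_comp {n : ℕ} (f : Fin n → Fin 2) (σ : Equiv.Perm (Fin n)) : wt (f ∘ σ) = wt f := by
  simp only [wt, Function.comp]
  exact Equiv.sum_comp σ (fun i => (f i : ℕ))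

lemma wt_le {n : ℕ} (f : Fin n → Fin 2) : wt f ≤ n := by
  have : wt f ≤ ∑ _i : Fin n, 1 := Finset.sum_le_sum (fun i _ => by have := (f i).2; omega)
  simpa using this

lemma card_wt (n k : ℕ) :
    (Finset.univ.filter (fun f : Fin n → Fin 2 => wt f = k)).card = n.choose k := by
  rw [Finset.card_filter]
  induction n generalizing k with
  | zero =>
    cases k <;> simp [wt]
  | succ n ih =>
    rw [← (Fin.consEquiv (fun _ : Fin (n+1) => Fin 2)).sum_comp, Fintype.sum_prod_type]
    simp only [Fin.consEquiv, Equiv.coe_fn_mk, wt_cons, Fin.sum_univ_two]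
    cases k with
    | zero =>
      have h0 := ih 0
      simp at h0 ⊢
      exact h0
    | succ k =>
      rw [Nat.choose_succ_succ, ← ih k, ← ih (k+1), add_comm]
      congr 1
      · refine Finset.sum_congr rfl fun x _ => ?_
        simp [add_comm 1]
      · simp

lemma sum_wt {E : Type*} [AddCommMonoid E] (n : ℕ) (F : ℕ → E) :
    ∑ g : Fin n → Fin 2, F (wt g) = ∑ k ∈ Finset.range (n+1), n.choose k • F k := by
  rw [← Finset.sum_fiberwise_of_maps_to (s := Finset.univ) (t := Finset.range (n+1))
    (g := fun g : Fin n → Fin 2 => wt g)]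
  · refine Finset.sum_congr rfl fun k _ => ?_
    rw [← card_wt, ← Finset.sum_const]
    refine Finset.sum_congr rfl fun f hf => ?_
    simp at hf; rw [hf]
  · intro f _; simp; have := wt_le f; omega

lemma sum_wt' {E : Type*} [AddCommMonoid E] (n : ℕ) (F : ℕ → E) (G : (Fin n → Fin 2) → E)
    (h : ∀ g, G g = F (wt g)) :
    ∑ g : Fin n → Fin 2, G g = ∑ k ∈ Finset.range (n+1), n.choose k • F k := by
  rw [← sum_wt]
  exact Finset.sum_congr rfl fun g _ => h g

/-- symmetric tensors -/
def IsSym {N : ℕ} (ψ : (Fin N → Fin 2) → ℂ) : Prop :=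
  ∀ σ : Equiv.Perm (Fin N), ∀ f, ψ (f ∘ σ) = ψ f

lemma exists_perm {n : ℕ} (f g : Fin n → Fin 2) (h : wt f = wt g) :
    ∃ σ : Equiv.Perm (Fin n), f = g ∘ σ := by
  have key : ∀ f : Fin n → Fin 2, Fintype.card {x // f x = 1} = wt f := by
    intro f
    rw [Fintype.card_subtype, wt, Finset.card_filter]
    refine Finset.sum_congr rfl fun i _ => ?_
    generalize f i = x
    fin_cases x <;> simp
  have key0 : ∀ f : Fin n → Fin 2, Fintype.card {x // f x = 0} + wt f = n := by
    intro f
    rw [Fintype.card_subtype, wt, Finset.card_filter, ← Finset.sum_add_distrib]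
    trans ∑ _i : Fin n, 1
    · refine Finset.sum_congr rfl fun i _ => ?_
      generalize f i = x
      fin_cases x <;> simp
    · simp
  have e : ∀ y : Fin 2, Fintype.card {x // f x = y} = Fintype.card {x // g x = y} := by
    have h1 := key f
    have h2 := key g
    have h3 := key0 f
    have h4 := key0 g
    rw [Fin.forall_fin_two]
    omega
  let E : ∀ y : Fin 2, {x // f x = y} ≃ {x // g x = y} := fun y => Fintype.equivOfCardEq (e y)
  refine ⟨(Equiv.sigmaFiberEquiv f).symm.trans
    ((Equiv.sigmaCongrRight E).trans (Equiv.sigmaFiberEquiv g)), ?_⟩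
  funext x
  exact (E (f x) ⟨x, rfl⟩).2.symm

/-- square root of binomial -/
def sq (N k : ℕ) : ℝ := Real.sqrt (N.choose k)

lemma sq_sq (N k : ℕ) : sq N k * sq N k = N.choose k := by
  unfold sq; exact Real.mul_self_sqrt (by positivity)

lemma sq_pos {N k : ℕ} (h : k ≤ N) : 0 < sq N k := by
  unfold sq; exact Real.sqrt_pos.2 (by exact_mod_cast Nat.choose_pos h)

/-- Dicke vector -/
def D (N k : ℕ) (f : Fin N → Fin 2) : ℂ := if wt f = k then ((sq N k)⁻¹ : ℝ) else 0

lemma D_sym (N k : ℕ) : IsSym (D N k) := by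
  intro σ f; simp [D, wt_comp]

/-- inner product -/
def ip {N : ℕ} (u ψ : (Fin N → Fin 2) → ℂ) : ℂ := ∑ f, star (u f) * ψ f

/-- Dicke coefficient -/
def c (N k : ℕ) (ψ : (Fin N → Fin 2) → ℂ) : ℂ := ip (D N k) ψ

lemma c_D {N k l : ℕ} (hl : l ≤ N) : c N k (D N l) = if k = l then 1 else 0 := by
  unfold c ip
  have : ∀ f : Fin N → Fin 2, star (D N k f) * D N l f =
      (fun j => if j = k then (if j = l then (((sq N k)⁻¹ * (sq N l)⁻¹ : ℝ) : ℂ) else 0) else 0) (wt f) := by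
    intro f
    simp only [D]
    split_ifs <;> simp
  rw [sum_wt' _ (fun j => if j = k then (if j = l then (((sq N k)⁻¹ * (sq N l)⁻¹ : ℝ) : ℂ) else 0) else 0) _ this]
  by_cases h : k = l
  · subst h
    have := sq_pos hl
    have h2 := sq_sq N k
    simp
    rw [if_pos (by omega), ← Complex.ofReal_natCast, ← h2]
    push_cast
    have : (sq N k : ℂ) ≠ 0 := by exact_mod_cast this.ne'
    field_simp
  · rw [if_neg h]
    refine Finset.sum_eq_zero fun j _ => ?_
    split_ifs with h1 h2
    · exact absurd (h1.symm.trans h2) h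
    · simp
    · simp

lemma ip_D {N k l : ℕ} (hl : l ≤ N) : ip (D N k) (D N l) = if k = l then 1 else 0 := c_D hl

lemma sym_apply {N : ℕ} {ψ : (Fin N → Fin 2) → ℂ} (h : IsSym ψ) (f : Fin N → Fin 2) :
    ψ f = c N (wt f) ψ * ((sq N (wt f))⁻¹ : ℝ) := by
  have e : c N (wt f) ψ = ∑ g ∈ Finset.univ.filter (fun g : Fin N → Fin 2 => wt g = wt f),
      (((sq N (wt f))⁻¹ : ℝ) : ℂ) * ψ f := by
    rw [Finset.sum_filter]
    unfold c ip
    refine Finset.sum_congr rfl fun g _ => ?_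
    unfold D
    split_ifs with h1
    · obtain ⟨σ, rfl⟩ := exists_perm g f h1
      rw [h]; simp
    · simp
  rw [e, Finset.sum_const, card_wt]
  have := sq_pos (wt_le f)
  have h2 := sq_sq N (wt f)
  rw [nsmul_eq_mul, ← Complex.ofReal_natCast, ← h2]
  push_cast
  have : (sq N (wt f) : ℂ) ≠ 0 := by exact_mod_cast this.ne'
  field_simp

lemma norm_sum {N : ℕ} {ψ : (Fin N → Fin 2) → ℂ} (h : IsSym ψ) :
    ∑ f, ‖ψ f‖ ^ 2 = ∑ k ∈ Finset.range (N+1), ‖c N k ψ‖ ^ 2 := by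
  have : ∀ f : Fin N → Fin 2, ‖ψ f‖ ^ 2 = (fun k => ‖c N k ψ‖^2 * ((sq N k)⁻¹)^2) (wt f) := by
    intro f
    conv_lhs => rw [sym_apply h f]
    rw [norm_mul, mul_pow, Complex.norm_real, Real.norm_eq_abs, sq_abs]
  rw [sum_wt' _ (fun k => ‖c N k ψ‖^2 * ((sq N k)⁻¹)^2) _ this]
  refine Finset.sum_congr rfl fun k hk => ?_
  have hk : k ≤ N := by simp at hk; omega
  have := sq_pos hk
  have h2 := sq_sq N k
  rw [nsmul_eq_mul, ← h2]
  field_simp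

lemma rho {M : ℕ} {ψ : (Fin (M+1) → Fin 2) → ℂ} (h : IsSym ψ) (i j : Fin 2) :
    ∑ g : Fin M → Fin 2, ψ (Fin.cons i g) * star (ψ (Fin.cons j g)) =
    ∑ k ∈ Finset.range (M+1),
      (((M.choose k : ℝ) * (sq (M+1) (i+k))⁻¹ * (sq (M+1) (j+k))⁻¹ : ℝ) : ℂ) *
      (c (M+1) (i+k) ψ * star (c (M+1) (j+k) ψ)) := by
  have : ∀ g : Fin M → Fin 2, ψ (Fin.cons i g) * star (ψ (Fin.cons j g)) =
    (fun k : ℕ => (((sq (M+1) (i+k))⁻¹ * (sq (M+1) (j+k))⁻¹ : ℝ) : ℂ) *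
      (c (M+1) (i+k) ψ * star (c (M+1) (j+k) ψ))) (wt g) := by
    intro g
    rw [sym_apply h (Fin.cons i g), sym_apply h (Fin.cons j g), wt_cons, wt_cons]
    simp
    ring
  rw [sum_wt' _ (fun k : ℕ => (((sq (M+1) (i+k))⁻¹ * (sq (M+1) (j+k))⁻¹ : ℝ) : ℂ) *
      (c (M+1) (i+k) ψ * star (c (M+1) (j+k) ψ))) _ this]
  refine Finset.sum_congr rfl fun k hk => ?_
  simp
  ring

/-- Householder reflection matrix -/
def R {N : ℕ} (u : (Fin N → Fin 2) → ℂ) (n : ℝ) : Matrix (Fin N → Fin 2) (Fin N → Fin 2) ℂ :=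
  1 - ((2 / n : ℝ) : ℂ) • Matrix.vecMulVec u (star u)

lemma R_mulVec {N : ℕ} (u ψ : (Fin N → Fin 2) → ℂ) (n : ℝ) :
    (R u n).mulVec ψ = fun f => ψ f - ((2 / n : ℝ) : ℂ) * ip u ψ * u f := by
  funext f
  rw [R, Matrix.sub_mulVec, Matrix.one_mulVec, Matrix.smul_mulVec, Matrix.vecMulVec_mulVec]
  simp [ip, dotProduct]
  ring

lemma R_unitary {N : ℕ} (u : (Fin N → Fin 2) → ℂ) (n : ℝ) (hn : n ≠ 0) (h : ip u u = n) :
    R u n ∈ Matrix.unitaryGroup (Fin N → Fin 2) ℂ := by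
  have hs : star (R u n) = R u n := by
    simp only [R, star_sub, star_one, Matrix.star_eq_conjTranspose, Matrix.conjTranspose_smul,
      Matrix.conjTranspose_vecMulVec, star_star]
    simp
  rw [Matrix.mem_unitaryGroup_iff, hs]
  have h' : star u ⬝ᵥ u = (n : ℂ) := by rw [← h]; simp [ip, dotProduct]
  have hn' : (n : ℂ) ≠ 0 := by exact_mod_cast hn
  simp only [R, sub_mul, mul_sub, one_mul, mul_one, Matrix.smul_mul, Matrix.mul_smul,
    Matrix.vecMulVec_mul_vecMulVec, h', Matrix.vecMulVec_smul, smul_smul]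
  have : (((2/n : ℝ) : ℂ) * (((2/n : ℝ) : ℂ) * (n:ℂ))) = ((2/n : ℝ) : ℂ) + ((2/n : ℝ) : ℂ) := by
    push_cast; field_simp; norm_num
  rw [this, add_smul]
  abel

lemma R_sym {N : ℕ} (u : (Fin N → Fin 2) → ℂ) (n : ℝ) (hu : IsSym u) (ψ : (Fin N → Fin 2) → ℂ)
    (h : IsSym ψ) : IsSym ((R u n).mulVec ψ) := by
  intro σ f
  simp only [R_mulVec]
  rw [h σ f, hu σ f]

lemma c_R {N : ℕ} (k : ℕ) (u ψ : (Fin N → Fin 2) → ℂ) (n : ℝ) :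
    c N k ((R u n).mulVec ψ) = c N k ψ - ((2 / n : ℝ) : ℂ) * ip u ψ * c N k u := by
  rw [R_mulVec]
  unfold c
  conv_lhs => rw [show ∀ φ, ip (D N k) φ = ∑ f, star (D N k f) * φ f from fun _ => rfl]
  conv_rhs => rw [show ip (D N k) ψ = ∑ f, star (D N k f) * ψ f from rfl,
    show ip (D N k) u = ∑ f, star (D N k f) * u f from rfl]
  generalize ((2 / n : ℝ) : ℂ) * ip u ψ = z
  rw [Finset.mul_sum, ← Finset.sum_sub_distrib]
  refine Finset.sum_congr rfl fun f _ => ?_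
  ring

@[fun_prop]
lemma c_cont (N k : ℕ) : Continuous (c N k) := by
  unfold c ip; fun_prop

/-- `D k + q D l` -/
def mix (N k l : ℕ) (q : ℂ) (f : Fin N → Fin 2) : ℂ := D N k f + q * D N l f

lemma mix_sym (N k l : ℕ) (q : ℂ) : IsSym (mix N k l q) := by
  intro σ f; simp only [mix]; rw [D_sym N k σ f, D_sym N l σ f]

lemma ip_mix (N k l : ℕ) (q : ℂ) (ψ : (Fin N → Fin 2) → ℂ) :
    ip (mix N k l q) ψ = c N k ψ + star q * c N l ψ := by
  simp only [c, ip, mix, Finset.mul_sum, ← Finset.sum_add_distrib]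
  refine Finset.sum_congr rfl fun f _ => ?_
  simp
  ring

lemma c_mix (N k l j : ℕ) (q : ℂ) (hk : k ≤ N) (hl : l ≤ N) :
    c N j (mix N k l q) = (if j = k then 1 else 0) + q * (if j = l then 1 else 0) := by
  rw [← c_D hk, ← c_D hl]
  simp only [c, ip, mix, Finset.mul_sum, ← Finset.sum_add_distrib]
  refine Finset.sum_congr rfl fun f _ => ?_
  ring

/-- the invariance and support data used below -/
structure Good (N : ℕ) (μ : Measure ((Fin N → Fin 2) → ℂ)) : Prop where
  inv : ∀ (u : (Fin N → Fin 2) → ℂ) (n : ℝ), IsSym u → n ≠ 0 → ip u u = n →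
    ∀ G : ((Fin N → Fin 2) → ℂ) → ℝ, Continuous G →
      ∫ ψ, G ((R u n).mulVec ψ) ∂μ = ∫ ψ, G ψ ∂μ
  sup : ∀ᵐ ψ ∂μ, IsSym ψ ∧ ∑ k ∈ Finset.range (N+1), ‖c N k ψ‖ ^ 2 = 1
  int : ∀ G : ((Fin N → Fin 2) → ℂ) → ℝ, Continuous G → Integrable G μ

lemma good_of {N : ℕ} (μ : Measure ((Fin N → Fin 2) → ℂ)) [IsProbabilityMeasure μ]
    (hsupp : μ {ψ | (∑ f : Fin N → Fin 2, ‖ψ f‖ ^ 2 = 1) ∧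
      ∀ σ : Equiv.Perm (Fin N), ∀ f, ψ (f ∘ σ) = ψ f}ᶜ = 0)
    (hinv : ∀ U : Matrix.unitaryGroup (Fin N → Fin 2) ℂ,
      (∀ ψ : (Fin N → Fin 2) → ℂ,
          (∀ σ : Equiv.Perm (Fin N), ∀ f, ψ (f ∘ σ) = ψ f) →
          ∀ σ : Equiv.Perm (Fin N), ∀ f,
            (U : Matrix (Fin N → Fin 2) (Fin N → Fin 2) ℂ).mulVec ψ (f ∘ σ)
              = (U : Matrix (Fin N → Fin 2) (Fin N → Fin 2) ℂ).mulVec ψ f) →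
        Measure.map (fun ψ =>
          (U : Matrix (Fin N → Fin 2) (Fin N → Fin 2) ℂ).mulVec ψ) μ = μ) :
    Good N μ := by
  have hae : ∀ᵐ ψ ∂μ, (∑ f : Fin N → Fin 2, ‖ψ f‖ ^ 2 = 1) ∧ IsSym ψ := hsupp
  refine ⟨?_, ?_, ?_⟩
  · intro u n hu hn h G hG
    have := hinv ⟨R u n, R_unitary u n hn h⟩ (fun ψ hψ => R_sym u n hu ψ hψ)
    simp only at this
    conv_rhs => rw [← this]
    rw [integral_map]
    · refine Continuous.aemeasurable ?_
      exact Continuous.matrix_mulVec continuous_const continuous_id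
    · exact hG.aestronglyMeasurable
  · filter_upwards [hae] with ψ h
    exact ⟨h.2, by rw [← norm_sum h.2, h.1]⟩
  · intro G hG
    have hK : IsCompact (Metric.closedBall (0 : (Fin N → Fin 2) → ℂ) 1) :=
      isCompact_closedBall _ _
    have h1 : IntegrableOn G (Metric.closedBall (0 : (Fin N → Fin 2) → ℂ) 1) μ :=
      hG.continuousOn.integrableOn_compact hK
    rw [IntegrableOn, Measure.restrict_eq_self_of_ae_mem] at h1
    · exact h1
    · filter_upwards [hae] with ψ h
      rw [mem_closedBall_zero_iff, pi_norm_le_iff_of_nonneg zero_le_one]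
      intro f
      have h2 : ‖ψ f‖ ^ 2 ≤ ∑ f : Fin N → Fin 2, ‖ψ f‖ ^ 2 :=
        Finset.single_le_sum (f := fun f => ‖ψ f‖ ^ 2) (fun _ _ => by positivity)
          (Finset.mem_univ f)
      rw [h.1] at h2
      nlinarith [norm_nonneg (ψ f)]

variable {N : ℕ} {μ : Measure ((Fin N → Fin 2) → ℂ)}

lemma mix_int (hμ : Good N μ) {k l : ℕ} (hk : k ≤ N) (hl : l ≤ N) (hkl : k ≠ l) (q : ℂ) (n : ℝ)
    (hn : n = 1 + Complex.normSq q) :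
    ∫ ψ, ‖c N k ψ - ((2 / n : ℝ) : ℂ) * (c N k ψ + star q * c N l ψ)‖ ^ 4 ∂μ
      = ∫ ψ, ‖c N k ψ‖ ^ 4 ∂μ := by
  have hn0 : n ≠ 0 := by have := Complex.normSq_nonneg q; linarith
  have := hμ.inv (mix N k l q) n (mix_sym _ _ _ _) hn0 (by
    rw [ip_mix, c_mix _ _ _ _ _ hk hl, c_mix _ _ _ _ _ hk hl, hn]
    simp [hkl, hkl.symm, Complex.normSq_eq_conj_mul_self]) (fun ψ => ‖c N k ψ‖ ^ 4) (by fun_prop)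
  rw [← this]
  congr 1
  funext ψ
  rw [c_R, ip_mix, c_mix _ _ _ _ _ hk hl]
  simp [hkl]

lemma swap_int (hμ : Good N μ) {k l : ℕ} (hk : k ≤ N) (hl : l ≤ N) :
    ∫ ψ, ‖c N k ψ‖ ^ 4 ∂μ = ∫ ψ, ‖c N l ψ‖ ^ 4 ∂μ := by
  by_cases hkl : k = l
  · rw [hkl]
  rw [← mix_int hμ hk hl hkl (-1) 2 (by simp; norm_num)]
  simp

lemma four_id (a b : ℂ) :
    ‖a - ((2 / 5 : ℝ) : ℂ) * (a + star (2 : ℂ) * b)‖ ^ 4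
    + ‖a - ((2 / 5 : ℝ) : ℂ) * (a + star (-2 : ℂ) * b)‖ ^ 4
    + ‖a - ((2 / 5 : ℝ) : ℂ) * (a + star (2 * Complex.I : ℂ) * b)‖ ^ 4
    + ‖a - ((2 / 5 : ℝ) : ℂ) * (a + star (-2 * Complex.I : ℂ) * b)‖ ^ 4
    = (4 / 625) * (81 * ‖a‖ ^ 4 + 256 * ‖b‖ ^ 4 + 576 * (‖a‖ ^ 2 * ‖b‖ ^ 2)) := by
  have h4 : ∀ z : ℂ, ‖z‖ ^ 4 = (z.re * z.re + z.im * z.im) ^ 2 := by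
    intro z
    rw [show ‖z‖ ^ 4 = (‖z‖ ^ 2) ^ 2 by ring, Complex.sq_norm, Complex.normSq_apply]
  simp only [h4, Complex.sq_norm, Complex.normSq_apply]
  simp
  ring

lemma pair_int (hμ : Good N μ) {k l : ℕ} (hk : k ≤ N) (hl : l ≤ N) (hkl : k ≠ l) :
    ∫ ψ, ‖c N k ψ‖ ^ 2 * ‖c N l ψ‖ ^ 2 ∂μ = (∫ ψ, ‖c N 0 ψ‖ ^ 4 ∂μ) / 2 := by
  have e1 := mix_int hμ hk hl hkl 2 5 (by simp [Complex.normSq_apply]; norm_num)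
  have e2 := mix_int hμ hk hl hkl (-2) 5 (by simp [Complex.normSq_apply]; norm_num)
  have e3 := mix_int hμ hk hl hkl (2 * Complex.I) 5 (by simp [Complex.normSq_apply]; norm_num)
  have e4 := mix_int hμ hk hl hkl (-2 * Complex.I) 5 (by simp [Complex.normSq_apply]; norm_num)
  have key := integral_congr_ae (μ := μ)
    (Filter.Eventually.of_forall fun ψ => four_id (c N k ψ) (c N l ψ))
  rw [integral_add (hμ.int _ (by fun_prop)) (hμ.int _ (by fun_prop)),
    integral_add (hμ.int _ (by fun_prop)) (hμ.int _ (by fun_prop)),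
    integral_add (hμ.int _ (by fun_prop)) (hμ.int _ (by fun_prop)), e1, e2, e3, e4,
    integral_const_mul,
    integral_add (hμ.int _ (by fun_prop)) (hμ.int _ (by fun_prop)),
    integral_add (hμ.int _ (by fun_prop)) (hμ.int _ (by fun_prop)),
    integral_const_mul, integral_const_mul, integral_const_mul, swap_int hμ hl hk,
    swap_int hμ hk (Nat.zero_le N)] at key
  linarith

lemma prod_int (hμ : Good N μ) {k l : ℕ} (hk : k ≤ N) (hl : l ≤ N) :
    ∫ ψ, ‖c N k ψ‖ ^ 2 * ‖c N l ψ‖ ^ 2 ∂μ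
      = (∫ ψ, ‖c N 0 ψ‖ ^ 4 ∂μ) / 2 * (1 + if k = l then 1 else 0) := by
  split_ifs with h
  · subst h
    rw [← swap_int hμ hk (Nat.zero_le N)]
    simp only [← pow_add]
    ring
  · rw [pair_int hμ hk hl h]; ring

lemma quad_int (hμ : Good N μ) (s : Finset ℕ) (p : ℕ → ℕ) (hp : ∀ k ∈ s, p k ≤ N)
    (hinj : ∀ k ∈ s, ∀ l ∈ s, p k = p l ↔ k = l) (a : ℕ → ℝ) :
    ∫ ψ, (∑ k ∈ s, a k * ‖c N (p k) ψ‖ ^ 2) ^ 2 ∂μ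
      = (∫ ψ, ‖c N 0 ψ‖ ^ 4 ∂μ) / 2 * ((∑ k ∈ s, a k) ^ 2 + ∑ k ∈ s, a k ^ 2) := by
  have : ∀ ψ, (∑ k ∈ s, a k * ‖c N (p k) ψ‖ ^ 2) ^ 2 =
      ∑ k ∈ s, ∑ l ∈ s, (a k * a l) * (‖c N (p k) ψ‖ ^ 2 * ‖c N (p l) ψ‖ ^ 2) := by
    intro ψ
    rw [_root_.sq, Finset.sum_mul_sum]
    refine Finset.sum_congr rfl fun k _ => Finset.sum_congr rfl fun l _ => ?_
    ring
  simp only [this]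
  rw [integral_finsetSum _ fun k _ => hμ.int _ (by fun_prop)]
  have h2 : ∀ k ∈ s, ∫ ψ, ∑ l ∈ s, (a k * a l) * (‖c N (p k) ψ‖ ^ 2 * ‖c N (p l) ψ‖ ^ 2) ∂μ
      = (∫ ψ, ‖c N 0 ψ‖ ^ 4 ∂μ) / 2 * (∑ l ∈ s, a k * a l + a k ^ 2) := by
    intro k hk
    rw [integral_finsetSum _ fun k _ => hμ.int _ (by fun_prop)]
    have : a k ^ 2 = ∑ l ∈ s, a k * a l * (if k = l then 1 else 0) := by
      simp [hk]; ring
    rw [this, ← Finset.sum_add_distrib, Finset.mul_sum]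
    refine Finset.sum_congr rfl fun l hl => ?_
    rw [integral_const_mul, prod_int hμ (hp k hk) (hp l hl)]
    simp only [hinj k hk l hl]
    ring
  rw [Finset.sum_congr rfl h2, ← Finset.mul_sum, Finset.sum_add_distrib, _root_.sq, Finset.sum_mul_sum]

lemma m_val [IsProbabilityMeasure μ] (hμ : Good N μ) :
    (∫ ψ, ‖c N 0 ψ‖ ^ 4 ∂μ) / 2 = 1 / ((N + 1) * (N + 2)) := by
  have h := quad_int hμ (Finset.range (N+1)) id (fun k hk => by simp at hk ⊢; omega)
    (fun _ _ _ _ => Iff.rfl) (fun _ => 1)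
  have h1 : ∫ ψ, (∑ k ∈ Finset.range (N+1), 1 * ‖c N (id k) ψ‖ ^ 2) ^ 2 ∂μ = 1 := by
    rw [integral_congr_ae (g := fun _ => (1:ℝ))]
    · simp
    · filter_upwards [hμ.sup] with ψ hψ
      simp only [id, one_mul, hψ.2, one_pow]
  rw [h1] at h
  simp at h
  rw [eq_div_iff (by positivity)]
  linarith

lemma zero_int (hμ : Good N μ) {k l : ℕ} (hk : k ≤ N) (hkl : k < l) :
    ∫ ψ, ((c N k ψ * star (c N (1 + k) ψ)) * star (c N l ψ * star (c N (1 + l) ψ))).re ∂μ = 0 := by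
  have := hμ.inv (D N k) 1 (D_sym N k) one_ne_zero (by rw [ip_D hk]; simp)
    (fun ψ => ((c N k ψ * star (c N (1 + k) ψ)) * star (c N l ψ * star (c N (1 + l) ψ))).re)
    (by fun_prop)
  simp only [c_R, c_D hk] at this
  rw [if_pos trivial, if_neg (by omega), if_neg (by omega), if_neg (by omega)] at this
  have e : ∀ ψ, c N k ψ - ((2 / 1 : ℝ) : ℂ) * ip (D N k) ψ * 1 = - c N k ψ := by
    intro ψ
    change c N k ψ - ((2 / 1 : ℝ) : ℂ) * c N k ψ * 1 = - c N k ψ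
    push_cast; ring
  simp only [e, mul_zero, sub_zero, neg_mul, Complex.neg_re] at this
  rw [integral_neg] at this
  linarith

lemma off_int (hμ : Good N μ) (s : Finset ℕ) (hp : ∀ k ∈ s, 1 + k ≤ N) (a : ℕ → ℝ) :
    ∫ ψ, ‖∑ k ∈ s, (a k : ℂ) * (c N k ψ * star (c N (1 + k) ψ))‖ ^ 2 ∂μ
      = (∫ ψ, ‖c N 0 ψ‖ ^ 4 ∂μ) / 2 * ∑ k ∈ s, a k ^ 2 := by
  have : ∀ ψ, ‖∑ k ∈ s, (a k : ℂ) * (c N k ψ * star (c N (1 + k) ψ))‖ ^ 2 =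
      ∑ k ∈ s, ∑ l ∈ s, (a k * a l) *
       ((c N k ψ * star (c N (1 + k) ψ)) * star (c N l ψ * star (c N (1 + l) ψ))).re := by
    intro ψ
    generalize hz : (fun k => c N k ψ * star (c N (1 + k) ψ)) = z
    have hz' : ∀ k, c N k ψ * star (c N (1 + k) ψ) = z k := fun k => congrFun hz k
    simp only [hz']
    rw [Complex.sq_norm, ← Complex.ofReal_re (Complex.normSq _), ← Complex.mul_conj, map_sum,
      Finset.sum_mul_sum, Complex.re_sum]
    refine Finset.sum_congr rfl fun k _ => ?_
    rw [Complex.re_sum]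
    refine Finset.sum_congr rfl fun l _ => ?_
    simp
    ring
  simp only [this]
  rw [integral_finsetSum _ fun k _ => hμ.int _ (by fun_prop), Finset.mul_sum]
  refine Finset.sum_congr rfl fun k hk => ?_
  rw [integral_finsetSum _ fun k _ => hμ.int _ (by fun_prop), Finset.sum_eq_single k]
  · rw [integral_const_mul, ← pair_int hμ (show k ≤ N by have := hp k hk; omega) (hp k hk) (by omega)]
    rw [← _root_.sq, mul_comm]
    congr 2
    funext ψ
    rw [← mul_pow, ← norm_star (c N (1 + k) ψ), ← norm_mul, Complex.sq_norm]
    generalize c N k ψ * star (c N (1 + k) ψ) = z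
    rw [← Complex.ofReal_re (Complex.normSq _), ← Complex.mul_conj]; rfl
  · intro l hl hlk
    rw [integral_const_mul]
    rcases lt_or_gt_of_ne hlk with h | h
    · have h0 := zero_int hμ (show l ≤ N by have := hp l hl; omega) h
      rw [mul_eq_zero]; right
      rw [← h0]
      congr 1
      funext ψ
      generalize c N k ψ * star (c N (1 + k) ψ) = z
      generalize c N l ψ * star (c N (1 + l) ψ) = y
      simp; ring
    · rw [zero_int hμ (show k ≤ N by have := hp k hk; omega) h, mul_zero]
  · intro h; exact absurd hk h

lemma rr (M k : ℕ) (hk : k ≤ M) : ((M.choose k : ℝ)) / (M+1).choose k = (M + 1 - k) / (M + 1) := by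
  have h := Nat.add_one_mul_choose_eq M k
  have h' := Nat.choose_mul_succ_eq M k
  have p1 : 0 < (M+1).choose k := Nat.choose_pos (by omega)
  have p1' : (0:ℝ) < (M+1).choose k := by exact_mod_cast p1
  rw [div_eq_div_iff (by positivity) (by positivity)]
  have : ((M.choose k : ℝ)) * (M+1) = (M+1).choose k * ((M + 1 - k : ℕ) : ℝ) := by exact_mod_cast h'
  rw [this, Nat.cast_sub (by omega)]
  push_cast; ring

lemma rr1 (M k : ℕ) (hk : k ≤ M) :
    ((M.choose k : ℝ)) / (M+1).choose (1 + k) = (k + 1) / (M + 1) := by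
  have h := Nat.add_one_mul_choose_eq M k
  rw [add_comm 1 k]
  have p1 : 0 < (M+1).choose (k+1) := Nat.choose_pos (by omega)
  have p1' : (0:ℝ) < (M+1).choose (k+1) := by exact_mod_cast p1
  rw [div_eq_div_iff (by positivity) (by positivity)]
  have : ((M:ℝ)+1) * (M.choose k : ℝ) = (M+1).choose (k+1) * (k + 1) := by exact_mod_cast h
  linarith

lemma S1 (n : ℕ) : ∑ k ∈ Finset.range n, ((k:ℝ) + 1) = n * (n + 1) / 2 := by
  induction n with
  | zero => simp
  | succ n ih => rw [Finset.sum_range_succ, ih]; push_cast; ring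

lemma S2 (n : ℕ) : ∑ k ∈ Finset.range n, ((k:ℝ) + 1) ^ 2 = (n:ℝ) * (n + 1) * (2 * n + 1) / 6 := by
  induction n with
  | zero => simp
  | succ n ih => rw [Finset.sum_range_succ, ih]; push_cast; ring

lemma S3 (n : ℕ) : ∑ k ∈ Finset.range (n+1), ((n:ℝ) + 1 - k) = (n+1) * (n + 2) / 2 := by
  have h := S1 (n+1)
  rw [← Finset.sum_range_reflect] at h
  push_cast at h
  rw [show ((n:ℝ)+1) * (n+2) = (n+1) * (n + 1 + 1) by ring, ← h]
  refine Finset.sum_congr rfl fun k hk => ?_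
  have : k ≤ n := by simp at hk; omega
  rw [Nat.cast_sub this]; ring

lemma S4 (n : ℕ) : ∑ k ∈ Finset.range (n+1), ((n:ℝ) + 1 - k) ^ 2
    = ((n:ℝ)+1) * (n + 2) * (2 * n + 3) / 6 := by
  have h := S2 (n+1)
  rw [← Finset.sum_range_reflect] at h
  push_cast at h
  rw [show ((n:ℝ)+1) * (n+2) * (2 * n + 3) = (n+1) * (n + 1 + 1) * (2 * (n + 1) + 1) by ring, ← h]
  refine Finset.sum_congr rfl fun k hk => ?_
  have : k ≤ n := by simp at hk; omega
  rw [Nat.cast_sub this]; ring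

lemma S5 (n : ℕ) : ∑ k ∈ Finset.range (n+1), ((n:ℝ) + 1 - k) * (k + 1)
    = ((n:ℝ)+1) * (n + 2) * (n + 3) / 6 := by
  have h1 := S1 (n+1)
  have h2 := S2 (n+1)
  have : ∀ k ∈ Finset.range (n+1), ((n:ℝ) + 1 - k) * (k + 1)
      = (n + 2) * ((k:ℝ) + 1) - ((k:ℝ) + 1) ^ 2 := fun k _ => by ring
  rw [Finset.sum_congr rfl this, Finset.sum_sub_distrib, ← Finset.mul_sum, h1, h2]
  push_cast
  ring

lemma diag_norm {N : ℕ} (s : Finset ℕ) (a : ℕ → ℝ) (p : ℕ → ℕ) (ψ : (Fin N → Fin 2) → ℂ) :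
    ‖∑ k ∈ s, (a k : ℂ) * (c N (p k) ψ * star (c N (p k) ψ))‖ ^ 2
      = (∑ k ∈ s, a k * ‖c N (p k) ψ‖ ^ 2) ^ 2 := by
  have : ∀ z : ℂ, z * star z = ((‖z‖ ^ 2 : ℝ) : ℂ) := by
    intro z; rw [Complex.sq_norm]; exact Complex.mul_conj z
  simp only [this, ← Complex.ofReal_mul, ← Complex.ofReal_sum]
  rw [Complex.norm_real, Real.norm_eq_abs, sq_abs]

/-- matrix coefficients of the reduced state -/
def A (M : ℕ) (i j k : ℕ) : ℝ := (M.choose k : ℝ) * (sq (M+1) (i+k))⁻¹ * (sq (M+1) (j+k))⁻¹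

lemma A00 (M k : ℕ) (hk : k ≤ M) : A M 0 0 k = (M + 1 - k) / (M + 1) := by
  rw [← rr M k hk, A, zero_add, mul_assoc, ← mul_inv, sq_sq]; rfl

lemma A11 (M k : ℕ) (hk : k ≤ M) : A M 1 1 k = (k + 1) / (M + 1) := by
  rw [← rr1 M k hk, A, mul_assoc, ← mul_inv, sq_sq]; rfl

lemma A01 (M k : ℕ) (hk : k ≤ M) : A M 0 1 k ^ 2 = (M + 1 - k) * (k + 1) / (M + 1) ^ 2 := by
  have : A M 0 1 k ^ 2 = A M 0 0 k * A M 1 1 k := by simp only [A]; ring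
  rw [this, A00 M k hk, A11 M k hk, div_mul_div_comm, _root_.sq]

theorem main (M : ℕ) (μ : Measure ((Fin (M + 1) → Fin 2) → ℂ)) [IsProbabilityMeasure μ]
    (hμ : Good (M+1) μ) :
    ∫ ψ, (∑ i : Fin 2, ∑ j : Fin 2,
        ‖∑ g : Fin M → Fin 2, ψ (Fin.cons i g) * star (ψ (Fin.cons j g))‖ ^ 2) ∂μ
      = 1 / 2 + 1 / (2 * (M + 1)) := by
  have hle : ∀ k ∈ Finset.range (M+1), k ≤ M := fun k hk => by simp at hk; omega
  have e00 := quad_int hμ (Finset.range (M+1)) (fun k => 0 + k)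
    (fun k hk => by have := hle k hk; omega) (fun _ _ _ _ => by omega) (A M 0 0)
  have e11 := quad_int hμ (Finset.range (M+1)) (fun k => 1 + k)
    (fun k hk => by have := hle k hk; omega) (fun _ _ _ _ => by omega) (A M 1 1)
  have e01 := off_int hμ (Finset.range (M+1))
    (fun k hk => by have := hle k hk; omega) (A M 0 1)
  rw [m_val hμ] at e00 e11 e01
  rw [Finset.sum_congr rfl fun k hk => A01 M k (hle k hk), ← Finset.sum_div, S5] at e01
  rw [Finset.sum_congr rfl fun k hk => A00 M k (hle k hk),
    Finset.sum_congr rfl fun k hk => congrArg (· ^ 2) (A00 M k (hle k hk))] at e00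
  rw [Finset.sum_congr rfl fun k hk => A11 M k (hle k hk),
    Finset.sum_congr rfl fun k hk => congrArg (· ^ 2) (A11 M k (hle k hk))] at e11
  simp only [div_pow] at e00 e11
  rw [← Finset.sum_div, ← Finset.sum_div, S3, S4] at e00
  rw [← Finset.sum_div, ← Finset.sum_div, S1, S2] at e11
  have hcongr : ∫ ψ, (∑ i : Fin 2, ∑ j : Fin 2,
        ‖∑ g : Fin M → Fin 2, ψ (Fin.cons i g) * star (ψ (Fin.cons j g))‖ ^ 2) ∂μ
      = ∫ ψ, ((∑ k ∈ Finset.range (M+1), A M 0 0 k * ‖c (M+1) (0 + k) ψ‖ ^ 2) ^ 2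
        + (∑ k ∈ Finset.range (M+1), A M 1 1 k * ‖c (M+1) (1 + k) ψ‖ ^ 2) ^ 2
        + 2 * ‖∑ k ∈ Finset.range (M+1), (A M 0 1 k : ℂ) *
            (c (M+1) k ψ * star (c (M+1) (1 + k) ψ))‖ ^ 2) ∂μ := by
    refine integral_congr_ae ?_
    filter_upwards [hμ.sup] with ψ hψ
    have h10 : ∑ g : Fin M → Fin 2, ψ (Fin.cons 1 g) * star (ψ (Fin.cons 0 g))
        = star (∑ g : Fin M → Fin 2, ψ (Fin.cons 0 g) * star (ψ (Fin.cons 1 g))) := by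
      rw [star_sum]
      refine Finset.sum_congr rfl fun g _ => ?_
      rw [star_mul, star_star]
    have h01 : ∑ g : Fin M → Fin 2, ψ (Fin.cons 0 g) * star (ψ (Fin.cons 1 g)) =
        ∑ k ∈ Finset.range (M+1), (A M 0 1 k : ℂ) *
            (c (M+1) k ψ * star (c (M+1) (1 + k) ψ)) := by
      rw [rho hψ.1 0 1]
      refine Finset.sum_congr rfl fun k _ => ?_
      simp [A]
    rw [← diag_norm (Finset.range (M+1)) (A M 0 0) (fun k => 0 + k),
      ← diag_norm (Finset.range (M+1)) (A M 1 1) (fun k => 1 + k), ← h01]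
    simp only [Fin.sum_univ_two]
    rw [h10, norm_star, rho hψ.1 0 0, rho hψ.1 1 1]
    simp only [A, Fin.val_zero, Fin.val_one]
    ring
  rw [hcongr, integral_add (hμ.int _ (by fun_prop)) (hμ.int _ (by fun_prop)),
    integral_add (hμ.int _ (by fun_prop)) (hμ.int _ (by fun_prop)), integral_const_mul,
    e00, e11, e01]
  push_cast
  field_simp
  ring

end Bos
end

/-- the expected reduced purity `‖ρ₁‖₂²` of a Haar-random pure state of
`N = M+1` bosonic qubits equals `1/2 + 1/(2N)`.  Here states are vectors
`ψ : (Fin N → Fin 2) → ℂ` in `(ℂ²)^{⊗N}`; `μ` is a probability measure concentrated on the unit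
vectors of the symmetric (bosonic) subspace `Sym^N(ℂ²)` and invariant under every unitary of
`(ℂ²)^{⊗N}` preserving that subspace (hence under every unitary of `Sym^N(ℂ²)`); the one-body
reduced density matrix is `(ρ₁)_{ij} = ∑_g ψ(i,g) conj ψ(j,g)` and the purity is its squared
Hilbert–Schmidt norm. -/
theorem stmt_15 (M : ℕ) (μ : Measure ((Fin (M + 1) → Fin 2) → ℂ)) [IsProbabilityMeasure μ]
    (hsupp : μ {ψ | (∑ f : Fin (M + 1) → Fin 2, ‖ψ f‖ ^ 2 = 1) ∧
      ∀ σ : Equiv.Perm (Fin (M + 1)), ∀ f, ψ (f ∘ σ) = ψ f}ᶜ = 0)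
    (hinv : ∀ U : Matrix.unitaryGroup (Fin (M + 1) → Fin 2) ℂ,
      (∀ ψ : (Fin (M + 1) → Fin 2) → ℂ,
          (∀ σ : Equiv.Perm (Fin (M + 1)), ∀ f, ψ (f ∘ σ) = ψ f) →
          ∀ σ : Equiv.Perm (Fin (M + 1)), ∀ f,
            (U : Matrix (Fin (M + 1) → Fin 2) (Fin (M + 1) → Fin 2) ℂ).mulVec ψ (f ∘ σ)
              = (U : Matrix (Fin (M + 1) → Fin 2) (Fin (M + 1) → Fin 2) ℂ).mulVec ψ f) →
        Measure.map (fun ψ =>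
          (U : Matrix (Fin (M + 1) → Fin 2) (Fin (M + 1) → Fin 2) ℂ).mulVec ψ) μ = μ) :
    ∫ ψ, (∑ i : Fin 2, ∑ j : Fin 2,
        ‖∑ g : Fin M → Fin 2, ψ (Fin.cons i g) * star (ψ (Fin.cons j g))‖ ^ 2) ∂μ
      = 1 / 2 + 1 / (2 * (M + 1)) := by
  exact Bos.main M μ (Bos.good_of μ hsupp hinv)
end
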